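/- arXiv:2209.10264 — 2 statements merged into one kernel-verified Lean document; each statement's English description precedes it below -/
import Mathlib

section
/- Let O(w) be an octagonal chain with n octagons (n ≥ 3) and w = (w_1,...,w_{n−2}), and suppose that for some index i ∈ {1,...,n−2} one has w_i = 1 or w_i = 3. Let w' = (w_1,...,w_{i−1}, 2, 4−w_{i+1},...,4−w_{n−2}). Then Kf(O(w)) < Kf(O(w')). -/
/-!  Common definitions: Moore–Penrose pseudoinverse, resistance distance and
Kirchhoff index of a simple graph (unit resistors), weighted electrical networks
(given by a symmetric conductance function), multigraph electrical networks,
and the octagonal chains `O(w)`.  -/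

/-- `M` is a Moore–Penrose pseudoinverse of `A`. -/
def Matrix.IsMoorePenroseInv {n : Type} [Fintype n] (A M : Matrix n n ℝ) : Prop :=
  A * M * A = A ∧ M * A * M = M ∧ (A * M).transpose = A * M ∧ (M * A).transpose = M * A

open Classical in
/-- The Moore–Penrose pseudoinverse of a real square matrix (it exists and is
unique; defined by choice). -/
noncomputable def mpinv {n : Type} [Fintype n] (A : Matrix n n ℝ) : Matrix n n ℝ :=
  if h : ∃ M, A.IsMoorePenroseInv M then h.choose else 0

open Classical in
/-- The (real) Laplacian matrix of a simple graph: degree diagonal minus adjacency. -/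
noncomputable def glap {V : Type} [Fintype V] (G : SimpleGraph V) : Matrix V V ℝ :=
  fun u v =>
    if u = v then ((Finset.univ.filter (fun t => G.Adj u t)).card : ℝ)
    else if G.Adj u v then -1 else 0

/-- Resistance distance `r_G(u,v) = (e_u - e_v)ᵀ L⁺ (e_u - e_v)` in a simple graph,
each edge being a unit resistor. -/
noncomputable def resDist {V : Type} [Fintype V] (G : SimpleGraph V) (u v : V) : ℝ :=
  mpinv (glap G) u u - mpinv (glap G) u v - mpinv (glap G) v u + mpinv (glap G) v v

/-- `r_G(a)`: the sum of the resistance distances between `a` and all other vertices. -/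
noncomputable def resSum {V : Type} [Fintype V] [DecidableEq V] (G : SimpleGraph V) (a : V) : ℝ :=
  ∑ b ∈ Finset.univ.erase a, resDist G a b

/-- The Kirchhoff index: the sum of resistance distances over all unordered pairs. -/
noncomputable def kirchhoff {V : Type} [Fintype V] (G : SimpleGraph V) : ℝ :=
  (∑ u, ∑ v, resDist G u v) / 2

/-- A weighted graph (electrical network) on `V`, recorded by its symmetric
conductance function: `cond u v` is the reciprocal of the resistance of the edge
`uv` (and `0` if there is no such edge). -/
structure Network (V : Type) where
  cond : V → V → ℝ
  symm : ∀ u v, cond u v = cond v u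
  nonneg : ∀ u v, 0 ≤ cond u v
  loopless : ∀ v, cond v v = 0

/-- The weighted Laplacian of a network. -/
noncomputable def Network.lap {V : Type} [Fintype V] [DecidableEq V] (N : Network V) :
    Matrix V V ℝ :=
  fun u v => if u = v then ∑ t, N.cond u t else -N.cond u v

/-- Effective resistance in a network, via the pseudoinverse of the weighted Laplacian. -/
noncomputable def Network.effRes {V : Type} [Fintype V] [DecidableEq V] (N : Network V)
    (u v : V) : ℝ :=
  mpinv N.lap u u - mpinv N.lap u v - mpinv N.lap v u + mpinv N.lap v v

/-- The underlying simple graph of a network. -/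
def Network.toGraph {V : Type} (N : Network V) : SimpleGraph V :=
  SimpleGraph.fromRel (fun u v => N.cond u v ≠ 0)

/-- An electrical network with multiple edges allowed: a finite edge type, each edge a
non-loop with two endpoints and a positive resistance. -/
structure MultiNetwork (V : Type) where
  E : Type
  [fE : Fintype E]
  ends : E → Sym2 V
  not_loop : ∀ e, ¬ (ends e).IsDiag
  res : E → ℝ
  res_pos : ∀ e, 0 < res e

attribute [instance] MultiNetwork.fE

/-- Total conductance between `u` and `v`: the sum, over all edges joining `u` and `v`,
of the reciprocals of their resistances. -/
noncomputable def MultiNetwork.cond {V : Type} [DecidableEq V] (M : MultiNetwork V)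
    (u v : V) : ℝ :=
  ∑ e ∈ Finset.univ.filter (fun e => M.ends e = s(u, v)), (M.res e)⁻¹

/-- The weighted Laplacian of a multigraph network. -/
noncomputable def MultiNetwork.lap {V : Type} [Fintype V] [DecidableEq V]
    (M : MultiNetwork V) : Matrix V V ℝ :=
  fun u v => if u = v then ∑ t, M.cond u t else -M.cond u v

/-- Effective resistance in a multigraph network. -/
noncomputable def MultiNetwork.effRes {V : Type} [Fintype V] [DecidableEq V]
    (M : MultiNetwork V) (u v : V) : ℝ :=
  mpinv M.lap u u - mpinv M.lap u v - mpinv M.lap v u + mpinv M.lap v v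

/-- The underlying simple graph of a multigraph network. -/
def MultiNetwork.toGraph {V : Type} (M : MultiNetwork V) : SimpleGraph V :=
  SimpleGraph.fromRel (fun u v => ∃ e, M.ends e = s(u, v))

/-!  The octagonal chain `O(w)` with `n` octagons, `w = (w_1, …, w_{n-2})`,
`w_i ∈ {0,1,2,3,4}`.  Its `6n+2` vertices are laid out along the outer boundary
cycle `0, 1, …, 6n+1`: position `0` is the top-left corner, the top boundary runs
rightwards (the top of the octagon `H_i`, `1 ≤ i ≤ n-2`, carries `w_i` inserted
vertices), then the right vertical edge, then the bottom boundary runs leftwards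
back to the bottom-left corner `6n+1`.  The graph is this outer cycle together
with the `n-1` chords `t_k b_k` shared by consecutive octagons. -/

/-- Boundary position of the top vertex `t_k` (`1 ≤ k ≤ n-1`) of the `k`-th shared
vertical edge: `t_k = k + w_1 + ⋯ + w_{k-1}`. -/
def tpos (n : ℕ) (w : Fin (n - 2) → Fin 5) (k : ℕ) : ℕ :=
  k + ∑ j ∈ Finset.univ.filter (fun j : Fin (n - 2) => (j : ℕ) + 1 < k), ((w j : ℕ))

/-- Boundary position of the bottom vertex `b_k` (`1 ≤ k ≤ n-1`) of the `k`-th shared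
vertical edge: `b_k = n + (w_1 + ⋯ + w_{n-2}) + 6 + Σ_{j ≥ k} (5 - w_j)`. -/
def bpos (n : ℕ) (w : Fin (n - 2) → Fin 5) (k : ℕ) : ℕ :=
  n + (∑ j, ((w j : ℕ))) + 6 +
    ∑ j ∈ Finset.univ.filter (fun j : Fin (n - 2) => k ≤ (j : ℕ) + 1), (5 - ((w j : ℕ)))

/-- The octagonal chain `O(w)` with `n` octagons: the outer boundary cycle on
`6n+2` vertices together with the chords `t_k b_k`, `k = 1, …, n-1`. -/
def octChain (n : ℕ) (w : Fin (n - 2) → Fin 5) : SimpleGraph (Fin (6 * n + 2)) :=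
  SimpleGraph.fromRel (fun a b =>
    ((a : ℕ) + 1 = (b : ℕ)) ∨ ((a : ℕ) = 6 * n + 1 ∧ (b : ℕ) = 0) ∨
    ∃ k, 1 ≤ k ∧ k ≤ n - 1 ∧ (a : ℕ) = tpos n w k ∧ (b : ℕ) = bpos n w k)

/-! ### Kernel of the tridiagonal matrix -/

def cs : ℕ → ℝ
  | 0 => 0
  | 1 => 1
  | (k+2) => 8 * cs (k+1) - cs k

lemma cs_rec (k : ℕ) : cs (k+2) = 8 * cs (k+1) - cs k := by rw [cs]

lemma cs_mono (k : ℕ) : 0 ≤ cs k ∧ cs k < cs (k+1) := by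
  induction k with
  | zero => simp [cs]
  | succ k ih =>
    obtain ⟨h1, h2⟩ := ih
    refine ⟨by linarith, ?_⟩
    rw [cs_rec]; linarith

lemma cs_pos (k : ℕ) (hk : 1 ≤ k) : 0 < cs k := by
  obtain ⟨j, rfl⟩ : ∃ j, k = j + 1 := ⟨k - 1, by omega⟩
  have := cs_mono j
  linarith [this.1, this.2]

lemma cs_cas (a b : ℕ) : cs (a+1) * cs (b+1) - cs a * cs b = cs (a+b+1) := by
  induction a generalizing b with
  | zero => simp [cs]
  | succ a ih =>
    have h1 := ih (b+1)
    have e : a + 1 + b + 1 = a + (b+1) + 1 := by ring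
    rw [e, ← h1, cs_rec a, cs_rec b]; ring

noncomputable def MM (n i j : ℕ) : ℝ := cs (min i j) * cs (n + 1 - max i j) / cs (n+1)

lemma MM_symm (n i j : ℕ) : MM n i j = MM n j i := by
  unfold MM; rw [min_comm, max_comm]

lemma MM_zero (n j : ℕ) : MM n 0 j = 0 := by
  simp [MM, cs]

lemma MM_end (n j : ℕ) (hj : j ≤ n) : MM n (n+1) j = 0 := by
  simp [MM, cs, max_eq_left (by omega : j ≤ n + 1)]

lemma MM_pos (n i j : ℕ) (h1 : 1 ≤ i) (h2 : 1 ≤ j) (h3 : i ≤ n) (h4 : j ≤ n) : 0 < MM n i j := by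
  unfold MM
  have := cs_pos (min i j) (by omega)
  have := cs_pos (n+1-max i j) (by omega)
  have := cs_pos (n+1) (by omega)
  positivity

lemma MM_rank (n i m j : ℕ) (h1 : i ≤ m) (h2 : m ≤ j) :
    MM n i j * MM n m m = MM n i m * MM n j m := by
  unfold MM
  rw [min_eq_left (h1.trans h2), max_eq_right (h1.trans h2), min_self, max_self, min_eq_left h1,
    max_eq_right h1, min_eq_right h2, max_eq_left h2]
  ring

lemma MM_rec (n i j : ℕ) (hi : i + 1 ≤ n) (hj : 1 ≤ j) (hjn : j ≤ n) :
    8 * MM n (i+1) j - MM n i j - MM n (i+2) j = if i + 1 = j then 1 else 0 := by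
  have hp := (cs_pos (n+1) (by omega)).ne'
  unfold MM
  rcases lt_trichotomy (i+1) j with h | h | h
  · rw [if_neg h.ne, min_eq_left h.le, max_eq_right h.le, min_eq_left (by omega : i ≤ j),
      max_eq_right (by omega : i ≤ j), min_eq_left (by omega : i + 2 ≤ j),
      max_eq_right (by omega : i + 2 ≤ j), cs_rec]
    ring
  · subst h
    rw [if_pos rfl, min_self, max_self, min_eq_left (by omega : i ≤ i + 1),
      max_eq_right (by omega : i ≤ i + 1), min_eq_right (by omega : i + 1 ≤ i + 2),
      max_eq_left (by omega : i + 1 ≤ i + 2)]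
    obtain ⟨c, rfl⟩ : ∃ c, n = i + 1 + c := ⟨n - (i+1), by omega⟩
    have h := cs_cas (i+1) c
    rw [cs_rec] at h
    rw [show i + 1 + c + 1 - (i+1) = c + 1 by omega, show i + 1 + c + 1 - (i+2) = c by omega]
    field_simp
    linarith
  · rw [if_neg h.ne', min_eq_right h.le, max_eq_left h.le, min_eq_right (by omega : j ≤ i),
      max_eq_left (by omega : j ≤ i), min_eq_right (by omega : j ≤ i + 2),
      max_eq_left (by omega : j ≤ i + 2)]
    obtain ⟨c, rfl⟩ : ∃ c, n = i + 1 + c := ⟨n - (i+1), by omega⟩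
    rw [show i + 1 + c + 1 - (i+1) = c + 1 by omega, show i + 1 + c + 1 - (i+2) = c by omega,
      show i + 1 + c + 1 - i = c + 2 by omega, cs_rec c]
    ring

/-! ### Chains: positions and labels -/

structure Ch (n : ℕ) (t b : ℕ → ℕ) : Prop where
  hn : 3 ≤ n
  t1 : t 1 = 1
  last : b (n-1) = t (n-1) + 7
  stepT : ∀ k, 1 ≤ k → k + 1 ≤ n - 1 → t k < t (k+1)
  stepB : ∀ k, 1 ≤ k → k + 1 ≤ n - 1 → b (k+1) < b k
  step : ∀ k, 1 ≤ k → k + 1 ≤ n - 1 → t (k+1) + b k = t k + b (k+1) + 6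

lemma Ch.lt {n t b} (h : Ch n t b) (j k : ℕ) (hj : 1 ≤ j) (hjk : j < k) (hk : k ≤ n - 1) :
    t j < t k ∧ b k < b j := by
  induction k, hjk using Nat.le_induction with
  | base => exact ⟨h.stepT j hj hk, h.stepB j hj hk⟩
  | succ k hk' ih =>
    have h1 := ih (by omega)
    have h2 := h.stepT k (by omega) hk
    have h3 := h.stepB k (by omega) hk
    omega

lemma Ch.gap {n t b} (h : Ch n t b) (k : ℕ) (hj : 1 ≤ k) (hk : k ≤ n - 1) :
    b k + 6 * k = t k + 6 * n + 1 := by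
  induction hk using Nat.decreasingInduction with
  | of_succ k hk ih =>
    have := ih (by omega)
    have := h.step k hj hk
    omega
  | self => have := h.last; have := h.hn; omega

lemma Ch.b1 {n t b} (h : Ch n t b) : b 1 = 6 * n - 4 := by
  have := h.gap 1 le_rfl (by have := h.hn; omega)
  have := h.t1
  omega

lemma Ch.bound {n t b} (h : Ch n t b) (k : ℕ) (hj : 1 ≤ k) (hk : k ≤ n - 1) :
    1 ≤ t k ∧ t k + 7 ≤ b k ∧ b k ≤ 6 * n - 4 := by
  have hb := h.b1
  have ht := h.t1
  have hg := h.gap k hj hk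
  rcases hj.eq_or_lt with rfl | h1
  · omega
  · have := h.lt 1 k le_rfl h1 hk
    omega

def lab (n : ℕ) (t b : ℕ → ℕ) (a : ℕ) : ℕ :=
  1 + ((Finset.Icc 1 (n-1)).filter (fun k => t k ≤ a ∧ a < b k)).card

lemma Ch.lab_gt {n t b} (h : Ch n t b) (k a : ℕ) (hj : 1 ≤ k) (hk : k ≤ n - 1) :
    k < lab n t b a ↔ t k ≤ a ∧ a < b k := by
  constructor
  · intro hl
    by_contra hc
    have hs : (Finset.Icc 1 (n-1)).filter (fun k => t k ≤ a ∧ a < b k) ⊆ Finset.Ico 1 k := by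
      intro j hj'
      simp only [Finset.mem_filter, Finset.mem_Icc, Finset.mem_Ico] at hj' ⊢
      refine ⟨hj'.1.1, ?_⟩
      by_contra hkj
      rcases (not_lt.1 hkj).eq_or_lt with rfl | h1
      · exact hc hj'.2
      · have := h.lt k j hj h1 hj'.1.2
        omega
    have := Finset.card_le_card hs
    simp only [Nat.card_Ico] at this
    unfold lab at hl
    omega
  · intro hl
    have hs : Finset.Icc 1 k ⊆ (Finset.Icc 1 (n-1)).filter (fun k => t k ≤ a ∧ a < b k) := by
      intro j hj'
      simp only [Finset.mem_filter, Finset.mem_Icc] at hj' ⊢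
      refine ⟨⟨hj'.1, by omega⟩, ?_⟩
      rcases hj'.2.eq_or_lt with rfl | h1
      · exact hl
      · have := h.lt j k hj'.1 h1 hk
        omega
    have := Finset.card_le_card hs
    simp only [Nat.card_Icc] at this
    unfold lab
    omega

lemma lab_pos (n t b a) : 1 ≤ lab n t b a := by unfold lab; omega

lemma lab_le (n : ℕ) (hn : 1 ≤ n) (t b a) : lab n t b a ≤ n := by
  unfold lab
  have := Finset.card_filter_le (Finset.Icc 1 (n-1)) (fun k => t k ≤ a ∧ a < b k)
  simp only [Nat.card_Icc] at this
  omega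

lemma Ch.lab_eq {n t b} (h : Ch n t b) (k a : ℕ) (hj : 1 ≤ k) (hk : k + 1 ≤ n - 1)
    (ha : t k ≤ a ∧ a < b k) (hb : ¬ (t (k+1) ≤ a ∧ a < b (k+1))) : lab n t b a = k + 1 := by
  have h1 := (h.lab_gt k a hj (by omega)).2 ha
  have h2 := mt (h.lab_gt (k+1) a (by omega) (by omega)).1 hb
  omega

lemma Ch.lab_tel {n t b} (h : Ch n t b) (f : ℕ → ℝ) (a : ℕ) :
    f (lab n t b a) = f 1 + ∑ k ∈ Finset.Icc 1 (n-1),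
      (if t k ≤ a ∧ a < b k then f (k+1) - f k else 0) := by
  have e1 : ∑ k ∈ Finset.Icc 1 (n-1), (if t k ≤ a ∧ a < b k then f (k+1) - f k else 0)
      = ∑ k ∈ Finset.Ico 1 (lab n t b a), (f (k+1) - f k) := by
    rw [← Finset.sum_filter]
    apply Finset.sum_congr _ (fun _ _ => rfl)
    ext k
    simp only [Finset.mem_filter, Finset.mem_Icc, Finset.mem_Ico]
    constructor
    · rintro ⟨h1, h2⟩
      exact ⟨h1.1, (h.lab_gt k a h1.1 h1.2).2 h2⟩
    · rintro ⟨h1, h2⟩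
      have := lab_le n (by have := h.hn; omega) t b a
      have h3 : k ≤ n - 1 := by omega
      exact ⟨⟨h1, h3⟩, (h.lab_gt k a h1 h3).1 h2⟩
  rw [e1, Finset.sum_Ico_sub f (lab_pos n t b a)]
  ring

lemma Ch.sum_arc {n t b} (h : Ch n t b) (j : ℕ) (hj1 : 1 ≤ j) (hjn : j ≤ n)
    (k : ℕ) (hk1 : 1 ≤ k) (hk : k ≤ n - 1) :
    ∑ a ∈ Finset.Ico (t k) (b k), MM n (lab n t b a) j
      = (if k < j then 1 else 0) - MM n (k+1) j + MM n k j := by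
  have hn := h.hn
  induction hk using Nat.decreasingInduction with
  | of_succ k hk ih =>
    have ih := ih (by omega)
    have h1 := h.stepT k hk1 hk
    have h2 := h.stepB k hk1 hk
    have h3 := h.step k hk1 hk
    have h4 := h.bound (k+1) (by omega) hk
    rw [← Finset.sum_Ico_consecutive _ h1.le (by omega : t (k+1) ≤ b k),
      ← Finset.sum_Ico_consecutive _ (by omega : t (k+1) ≤ b (k+1)) h2.le, ih]
    have e1 : ∑ a ∈ Finset.Ico (t k) (t (k+1)), MM n (lab n t b a) j
        = ∑ a ∈ Finset.Ico (t k) (t (k+1)), MM n (k+1) j := by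
      apply Finset.sum_congr rfl
      intro a ha
      rw [Finset.mem_Ico] at ha
      rw [h.lab_eq k a hk1 hk (by omega) (by omega)]
    have e2 : ∑ a ∈ Finset.Ico (b (k+1)) (b k), MM n (lab n t b a) j
        = ∑ a ∈ Finset.Ico (b (k+1)) (b k), MM n (k+1) j := by
      apply Finset.sum_congr rfl
      intro a ha
      rw [Finset.mem_Ico] at ha
      rw [h.lab_eq k a hk1 hk (by omega) (by omega)]
    rw [e1, e2, Finset.sum_const, Finset.sum_const, Nat.card_Ico, Nat.card_Ico, nsmul_eq_mul,
      nsmul_eq_mul]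
    have e3 : ((t (k+1) - t k : ℕ) : ℝ) + ((b k - b (k+1) : ℕ) : ℝ) = 6 := by
      have : (t (k+1) - t k) + (b k - b (k+1)) = 6 := by omega
      exact_mod_cast this
    have h5 := MM_rec n k j (by omega) hj1 hjn
    have h6 : (if k < j then (1:ℝ) else 0) = (if k + 1 < j then 1 else 0)
        + (if k + 1 = j then 1 else 0) := by
      split_ifs <;> first | omega | norm_num
    rw [h6, ← h5]
    linear_combination (MM n (k+1) j) * e3
  | self =>
    have h4 := h.last
    have e1 : ∑ a ∈ Finset.Ico (t (n-1)) (b (n-1)), MM n (lab n t b a) j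
        = ∑ a ∈ Finset.Ico (t (n-1)) (b (n-1)), MM n n j := by
      apply Finset.sum_congr rfl
      intro a ha
      rw [Finset.mem_Ico] at ha
      have h1 := (h.lab_gt (n-1) a hk1 le_rfl).2 ha
      have h2 := lab_le n (by omega) t b a
      rw [show lab n t b a = n by omega]
    rw [e1, Finset.sum_const, Nat.card_Ico, h4, nsmul_eq_mul]
    have h5 := MM_rec n (n-1) j (by omega) hj1 hjn
    rw [show n - 1 + 1 = n by omega, show n - 1 + 2 = n + 1 by omega, MM_end n j hjn] at h5
    have h6 : (if n - 1 < j then (1:ℝ) else 0) = (if n = j then 1 else 0) := by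
      split_ifs <;> first | omega | norm_num
    rw [h6, ← h5, show n - 1 + 1 = n by omega, show t (n-1) + 7 - t (n-1) = 7 by omega]
    push_cast
    ring

lemma Ch.lab_one {n t b} (h : Ch n t b) (a : ℕ) (ha : a < 1 ∨ 6 * n - 4 ≤ a) :
    lab n t b a = 1 := by
  have hn := h.hn
  have h1 := mt (h.lab_gt 1 a le_rfl (by omega)).1 (by rw [h.t1, h.b1]; omega)
  have := lab_pos n t b a
  omega

lemma Ch.sum_all {n t b} (h : Ch n t b) (j : ℕ) (hj1 : 1 ≤ j) (hjn : j ≤ n) :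
    ∑ a ∈ Finset.range (6 * n + 2), MM n (lab n t b a) j = 1 := by
  have hn := h.hn
  have h0 := h.sum_arc j hj1 hjn 1 le_rfl (by omega)
  rw [h.t1, h.b1] at h0
  rw [Finset.range_eq_Ico, ← Finset.sum_Ico_consecutive _ (by omega : 0 ≤ 1)
    (by omega : 1 ≤ 6 * n + 2), ← Finset.sum_Ico_consecutive _ (by omega : 1 ≤ 6 * n - 4)
    (by omega : 6 * n - 4 ≤ 6 * n + 2), h0]
  have e1 : ∑ a ∈ Finset.Ico 0 1, MM n (lab n t b a) j = MM n 1 j := by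
    simp [h.lab_one 0 (by omega)]
  have e2 : ∑ a ∈ Finset.Ico (6 * n - 4) (6 * n + 2), MM n (lab n t b a) j
      = ∑ a ∈ Finset.Ico (6 * n - 4) (6 * n + 2), MM n 1 j := by
    apply Finset.sum_congr rfl
    intro a ha
    rw [Finset.mem_Ico] at ha
    rw [h.lab_one a (by omega)]
  rw [e1, e2, Finset.sum_const, Nat.card_Ico, nsmul_eq_mul,
    show 6 * n + 2 - (6 * n - 4) = 6 by omega]
  have h5 := MM_rec n 0 j (by omega) hj1 hjn
  rw [MM_zero] at h5
  have h6 : (if 0 + 1 = j then (1:ℝ) else 0) = 1 - (if 1 < j then (1:ℝ) else 0) := by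
    split_ifs <;> first | omega | norm_num
  rw [h6] at h5
  simp only [zero_add] at h5
  push_cast
  norm_num at h5 ⊢
  linarith

/-! ### Laplacian, pseudoinverse -/

open Classical in
lemma glap_sum {V : Type} [Fintype V] (G : SimpleGraph V) (u : V) (f : V → ℝ) :
    ∑ v, glap G u v * f v = ∑ v, if G.Adj u v then f u - f v else 0 := by
  have e : ∀ v, glap G u v * f v = (if u = v then ((Finset.univ.filter
      (fun t => G.Adj u t)).card : ℝ) * f u else 0) - (if G.Adj u v then f v else 0) := by
    intro v
    unfold glap
    by_cases h : u = v
    · subst h; simp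
    · by_cases h2 : G.Adj u v <;> simp [h, h2]
  have e2 : ∀ v, (if G.Adj u v then f u - f v else 0)
      = (if G.Adj u v then f u else 0) - (if G.Adj u v then f v else 0) := by
    intro v; split_ifs <;> simp
  simp_rw [e, e2]
  rw [Finset.sum_sub_distrib, Finset.sum_sub_distrib]
  congr 1
  rw [Finset.sum_ite_eq, if_pos (Finset.mem_univ _), ← Finset.sum_filter, Finset.sum_const,
    nsmul_eq_mul]

lemma glap_symm {V : Type} [Fintype V] (G : SimpleGraph V) : (glap G).transpose = glap G := by
  classical
  ext u v
  simp only [Matrix.transpose_apply, glap]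
  by_cases h : u = v
  · subst h; simp
  · simp [h, Ne.symm h, G.adj_comm]

lemma resDist_of_green {V : Type} [Fintype V] [DecidableEq V] (G : SimpleGraph V)
    (S : Matrix V V ℝ) (z : V) (hS : S.transpose = S)
    (hLS : ∀ x y, (glap G * S) x y = (if x = y then 1 else 0) - (if x = z then 1 else 0))
    (u v : V) : resDist G u v = S u u + S v v - 2 * S u v := by
  classical
  set L := glap G with hL
  have hLt : L.transpose = L := glap_symm G
  set N : ℝ := (Fintype.card V : ℝ) with hN
  have hN0 : N ≠ 0 := by
    have : 0 < Fintype.card V := Fintype.card_pos_iff.2 ⟨z⟩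
    positivity
  let J : Matrix V V ℝ := fun _ _ => N⁻¹
  let Z : Matrix V V ℝ := fun x _ => if x = z then 1 else 0
  have hJt : J.transpose = J := by ext; rfl
  have hLS' : L * S = 1 - Z := by
    ext x y
    rw [hLS, Matrix.sub_apply, Matrix.one_apply]
  have hLJ : L * J = 0 := by
    ext x y
    rw [Matrix.mul_apply]
    have := glap_sum G x (fun _ => N⁻¹)
    simpa [J] using this
  have hJL : J * L = 0 := by
    have := congrArg Matrix.transpose hLJ
    rwa [Matrix.transpose_mul, hLt, hJt, Matrix.transpose_zero] at this
  have hZJ : Z * J = Z := by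
    ext x y
    rw [Matrix.mul_apply]
    simp only [J, Z, Finset.sum_const, Finset.card_univ, nsmul_eq_mul]
    split_ifs
    · rw [one_mul, ← hN, mul_inv_cancel₀ hN0]
    · simp
  let P : Matrix V V ℝ := 1 - J
  have hPt : P.transpose = P := by simp [P, Matrix.transpose_sub, hJt]
  have hLP : L * P = L := by simp [P, Matrix.mul_sub, hLJ]
  have hPL : P * L = L := by simp [P, Matrix.sub_mul, hJL]
  have hJJ : J * J = J := by
    ext x y
    rw [Matrix.mul_apply]
    simp only [J, Finset.sum_const, Finset.card_univ, nsmul_eq_mul]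
    rw [← hN, mul_inv_cancel_left₀ hN0]
  have hPP : P * P = P := by
    simp only [P, Matrix.mul_sub, Matrix.sub_mul, hJJ, Matrix.one_mul, Matrix.mul_one]
    abel
  let Q := P * S * P
  have hQt : Q.transpose = Q := by
    simp only [Q, Matrix.transpose_mul, hPt, hS, Matrix.mul_assoc]
  have hLQ : L * Q = P := by
    have : L * Q = (L * S) * P := by
      simp only [Q, ← Matrix.mul_assoc, hLP]
    rw [this, hLS']
    simp only [P, Matrix.mul_sub, Matrix.sub_mul, hZJ, Matrix.one_mul, Matrix.mul_one]
    abel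
  have hQL : Q * L = P := by
    have := congrArg Matrix.transpose hLQ
    rwa [Matrix.transpose_mul, hLt, hQt, hPt] at this
  have hex : ∃ M, L.IsMoorePenroseInv M := by
    refine ⟨Q, ?_, ?_, ?_, ?_⟩
    · rw [hLQ, hPL]
    · rw [hQL]; simp only [Q, ← Matrix.mul_assoc, hPP]
    · rw [hLQ, hPt]
    · rw [hQL, hPt]
  have hM : L * mpinv L * L = L := by
    unfold mpinv
    rw [dif_pos hex]
    exact hex.choose_spec.1
  set M := mpinv L with hMd
  have hSL : S * L = 1 - Z.transpose := by
    have := congrArg Matrix.transpose hLS'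
    rwa [Matrix.transpose_mul, hLt, hS, Matrix.transpose_sub, Matrix.transpose_one] at this
  have key : (1 - Z.transpose) * M * (1 - Z) = S - Z.transpose * S := by
    have h1 : S * (L * M * L) * S = S * L * S := by rw [hM]
    have h2 : S * (L * M * L) * S = (S * L) * M * (L * S) := by
      simp only [Matrix.mul_assoc]
    rw [h2, hSL, hLS'] at h1
    rw [h1, Matrix.sub_mul, Matrix.one_mul]
  have hk : ∀ x y, M x y - M z y - M x z + M z z = S x y - S z y := by
    intro x y
    have h1 : ∀ (A : Matrix V V ℝ) x y, (Z.transpose * A) x y = A z y := by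
      intro A x y
      rw [Matrix.mul_apply]
      simp only [Matrix.transpose_apply]
      simp [Z]
    have h2 : ∀ (A : Matrix V V ℝ) x y, (A * Z) x y = A x z := by
      intro A x y
      rw [Matrix.mul_apply]
      simp [Z]
    have := congrFun (congrFun key x) y
    rw [Matrix.mul_sub, Matrix.mul_one, Matrix.sub_mul, Matrix.one_mul, Matrix.sub_apply,
      Matrix.sub_apply, h2, Matrix.sub_apply, Matrix.sub_apply, h1, h1, h1] at this
    linarith
  have hs : S v u = S u v := congrFun (congrFun hS u) v
  unfold resDist
  rw [← hL, ← hMd]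
  linarith [hk u u, hk u v, hk v u, hk v v]

/-! ### Green kernel of a chain -/

noncomputable def TT (n : ℕ) (t b : ℕ → ℕ) (a c : ℕ) : ℝ :=
  (if a = c then 1 else 0) - MM n (lab n t b a) (lab n t b c)

noncomputable def SS (n : ℕ) (t b : ℕ → ℕ) (x y : ℕ) : ℝ :=
  ∑ a ∈ Finset.range x, ∑ c ∈ Finset.range y, TT n t b a c

lemma TT_symm (n t b a c) : TT n t b a c = TT n t b c a := by
  unfold TT; rw [MM_symm]; simp only [eq_comm]

lemma SS_symm (n t b x y) : SS n t b x y = SS n t b y x := by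
  unfold SS
  rw [Finset.sum_comm]
  simp_rw [TT_symm n t b]

lemma Ch.TT_row {n t b} (h : Ch n t b) (c : ℕ) (hc : c < 6 * n + 2) :
    ∑ a ∈ Finset.range (6 * n + 2), TT n t b a c = 0 := by
  unfold TT
  rw [Finset.sum_sub_distrib, h.sum_all _ (lab_pos n t b c)
    (lab_le n (by have := h.hn; omega) t b c)]
  simp [hc]

/-- flow -/
noncomputable def psi (n : ℕ) (t b : ℕ → ℕ) (y a : ℕ) : ℝ :=
  ∑ c ∈ Finset.range y, TT n t b a c

noncomputable def YY (n : ℕ) (t b : ℕ → ℕ) (y k : ℕ) : ℝ :=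
  ∑ c ∈ Finset.range y, MM n k (lab n t b c)

lemma psi_eq (n t b y a) : psi n t b y a = (if a < y then 1 else 0) - YY n t b y (lab n t b a) := by
  unfold psi YY TT
  rw [Finset.sum_sub_distrib]
  simp

lemma SS_succ (n t b x y) : SS n t b (x+1) y = SS n t b x y + psi n t b y x := by
  unfold SS psi
  rw [Finset.sum_range_succ]

lemma SS_zero (n t b y) : SS n t b 0 y = 0 := by simp [SS]

lemma Ch.SS_N {n t b} (h : Ch n t b) (y : ℕ) (hy : y ≤ 6 * n + 2) : SS n t b (6*n+2) y = 0 := by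
  unfold SS
  rw [Finset.sum_comm]
  apply Finset.sum_eq_zero
  intro c hc
  rw [Finset.mem_range] at hc
  exact h.TT_row c (by omega)

lemma Ch.chord {n t b} (h : Ch n t b) (y k : ℕ) (hk1 : 1 ≤ k) (hk : k ≤ n - 1) :
    SS n t b (b k) y - SS n t b (t k) y = YY n t b y (k+1) - YY n t b y k := by
  have hb := h.bound k hk1 hk
  have e : SS n t b (b k) y - SS n t b (t k) y
      = ∑ c ∈ Finset.range y, ∑ a ∈ Finset.Ico (t k) (b k), TT n t b a c := by
    rw [Finset.sum_comm, Finset.sum_Ico_eq_sub _ (by omega : t k ≤ b k)]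
    rfl
  rw [e]
  unfold YY
  rw [← Finset.sum_sub_distrib]
  apply Finset.sum_congr rfl
  intro c _
  unfold TT
  rw [Finset.sum_sub_distrib, h.sum_arc _ (lab_pos n t b c)
    (lab_le n (by have := h.hn; omega) t b c) k hk1 hk]
  have e2 : (if k < lab n t b c then (1:ℝ) else 0) = if t k ≤ c ∧ c < b k then 1 else 0 := by
    simp only [h.lab_gt k c hk1 hk]
  rw [e2, Finset.sum_ite_eq']
  simp only [Finset.mem_Ico]
  ring

lemma Ch.div {n t b} (h : Ch n t b) (y a : ℕ) :
    psi n t b y a - psi n t b y (a+1) = (if a + 1 = y then 1 else 0)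
      + ∑ k ∈ Finset.Icc 1 (n-1), ((if a + 1 = t k then YY n t b y (k+1) - YY n t b y k else 0)
        - (if a + 1 = b k then YY n t b y (k+1) - YY n t b y k else 0)) := by
  rw [psi_eq, psi_eq, h.lab_tel (YY n t b y) a, h.lab_tel (YY n t b y) (a+1)]
  have e : ∀ k ∈ Finset.Icc 1 (n-1),
      ((if a + 1 = t k then YY n t b y (k+1) - YY n t b y k else 0)
        - (if a + 1 = b k then YY n t b y (k+1) - YY n t b y k else 0))
      = (if t k ≤ a + 1 ∧ a + 1 < b k then YY n t b y (k+1) - YY n t b y k else 0)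
        - (if t k ≤ a ∧ a < b k then YY n t b y (k+1) - YY n t b y k else 0) := by
    intro k hk
    rw [Finset.mem_Icc] at hk
    have := h.bound k hk.1 hk.2
    split_ifs <;> first | omega | simp
  rw [Finset.sum_congr rfl e, Finset.sum_sub_distrib]
  have e2 : (if a + 1 = y then (1:ℝ) else 0) = (if a < y then 1 else 0)
      - (if a + 1 < y then 1 else 0) := by
    split_ifs <;> first | omega | simp
  rw [e2]
  ring

def cgraph (n : ℕ) (t b : ℕ → ℕ) : SimpleGraph (Fin (6 * n + 2)) :=
  SimpleGraph.fromRel (fun a c =>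
    ((a : ℕ) + 1 = (c : ℕ)) ∨ ((a : ℕ) = 6 * n + 1 ∧ (c : ℕ) = 0) ∨
    ∃ k, 1 ≤ k ∧ k ≤ n - 1 ∧ (a : ℕ) = t k ∧ (c : ℕ) = b k)

open Classical in
lemma Ch.chord_ind {n t b} (h : Ch n t b) (a c : ℕ) (r : ℝ) :
    (∑ k ∈ Finset.Icc 1 (n-1), if a = t k ∧ c = b k then r else 0)
      = if ∃ k, 1 ≤ k ∧ k ≤ n - 1 ∧ a = t k ∧ c = b k then r else 0 := by
  split_ifs with hex
  · obtain ⟨k, h1, h2, h3, h4⟩ := hex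
    rw [Finset.sum_eq_single k]
    · simp [h3, h4]
    · intro j hj hjk
      rw [Finset.mem_Icc] at hj
      rw [if_neg]
      rintro ⟨h5, h6⟩
      rcases lt_or_gt_of_ne hjk with h7 | h7
      · have := h.lt j k hj.1 h7 h2; omega
      · have := h.lt k j h1 h7 hj.2; omega
    · intro hk
      rw [Finset.mem_Icc] at hk
      omega
  · apply Finset.sum_eq_zero
    intro k hk
    rw [Finset.mem_Icc] at hk
    rw [if_neg]
    intro h5
    exact hex ⟨k, hk.1, hk.2, h5⟩

open Classical in
lemma Ch.adj_ind {n t b} (h : Ch n t b) (a c : Fin (6*n+2)) (r : ℝ) :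
    (if (cgraph n t b).Adj a c then r else 0)
      = (if (c:ℕ) = a + 1 then r else 0) + (if (a:ℕ) = c + 1 then r else 0)
      + (if (a:ℕ) = 6 * n + 1 ∧ (c:ℕ) = 0 then r else 0)
      + (if (c:ℕ) = 6 * n + 1 ∧ (a:ℕ) = 0 then r else 0)
      + (∑ k ∈ Finset.Icc 1 (n-1), if (a:ℕ) = t k ∧ (c:ℕ) = b k then r else 0)
      + (∑ k ∈ Finset.Icc 1 (n-1), if (c:ℕ) = t k ∧ (a:ℕ) = b k then r else 0) := by
  rw [h.chord_ind, h.chord_ind]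
  have hn := h.hn
  have ha := a.2
  have hc := c.2
  have e1 : ∀ x y : ℕ, (∃ k, 1 ≤ k ∧ k ≤ n - 1 ∧ x = t k ∧ y = b k) →
      1 ≤ x ∧ x + 7 ≤ y ∧ y ≤ 6 * n - 4 := by
    rintro x y ⟨k, h1, h2, rfl, rfl⟩
    exact h.bound k h1 h2
  have h1 := e1 a c
  have h2 := e1 c a
  unfold cgraph
  rw [SimpleGraph.fromRel_adj]
  generalize (∃ k, 1 ≤ k ∧ k ≤ n - 1 ∧ (a:ℕ) = t k ∧ (c:ℕ) = b k) = p at *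
  generalize (∃ k, 1 ≤ k ∧ k ≤ n - 1 ∧ (c:ℕ) = t k ∧ (a:ℕ) = b k) = q at *
  rw [Ne, Fin.ext_iff]
  generalize (a:ℕ) = a at *
  generalize (c:ℕ) = c at *
  by_cases hp : p <;> by_cases hq : q <;>
    simp only [hp, hq, true_imp_iff, false_imp_iff, or_true, or_false, if_true, if_false,
      true_or, and_true] at h1 h2 ⊢ <;>
    split_ifs <;> first | (exfalso; omega) | simp

lemma Ch.green {n t b} (h : Ch n t b) (a : Fin (6*n+2)) (y : ℕ) (hy : y < 6 * n + 2) :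
    ∑ c, glap (cgraph n t b) a c * SS n t b c y
      = (if (a:ℕ) = y then 1 else 0) - (if (a:ℕ) = 0 then 1 else 0) := by
  classical
  have hn := h.hn
  have ha := a.2
  rw [glap_sum (cgraph n t b) a (fun c => SS n t b c y)]
  simp_rw [h.adj_ind]
  simp only [Finset.sum_add_distrib]
  set φ : ℕ → ℝ := fun x => SS n t b x y with hφ
  have hφN : φ (6*n+2) = 0 := h.SS_N y hy.le
  have hφ0 : φ 0 = 0 := SS_zero n t b y
  have hφs : ∀ x, φ (x+1) = φ x + psi n t b y x := fun x => SS_succ n t b x y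
  have hch : ∀ k ∈ Finset.Icc 1 (n-1), φ (b k) - φ (t k) = YY n t b y (k+1) - YY n t b y k := by
    intro k hk
    rw [Finset.mem_Icc] at hk
    exact h.chord y k hk.1 hk.2
  generalize (a:ℕ) = a at *
  have c1 : ∑ c : Fin (6*n+2), (if (c:ℕ) = a + 1 then φ a - φ c else 0)
      + ∑ c : Fin (6*n+2), (if a = 6 * n + 1 ∧ (c:ℕ) = 0 then φ a - φ c else 0)
      = φ a - φ (a+1) := by
    rw [Fin.sum_univ_eq_sum_range (fun c => if c = a + 1 then φ a - φ c else 0),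
      Fin.sum_univ_eq_sum_range (fun c => if a = 6 * n + 1 ∧ c = 0 then φ a - φ c else 0)]
    by_cases h1 : a = 6 * n + 1
    · subst h1; simp [hφN, hφ0]
    · simp [h1, show a + 1 < 6 * n + 2 by omega]
  have c2 : ∑ c : Fin (6*n+2), (if a = (c:ℕ) + 1 then φ a - φ c else 0)
      + ∑ c : Fin (6*n+2), (if (c:ℕ) = 6 * n + 1 ∧ a = 0 then φ a - φ c else 0)
      = if a = 0 then - φ (6*n+1) else φ a - φ (a-1) := by
    rw [Fin.sum_univ_eq_sum_range (fun c => if a = c + 1 then φ a - φ c else 0),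
      Fin.sum_univ_eq_sum_range (fun c => if c = 6 * n + 1 ∧ a = 0 then φ a - φ c else 0)]
    by_cases h1 : a = 0
    · subst h1; simp [hφ0]
    · obtain ⟨d, rfl⟩ : ∃ d, a = d + 1 := ⟨a - 1, by omega⟩
      simp [show d < 6 * n + 2 by omega]
  have c3 : ∑ c : Fin (6*n+2), ∑ k ∈ Finset.Icc 1 (n-1),
        (if a = t k ∧ (c:ℕ) = b k then φ a - φ c else 0)
      = ∑ k ∈ Finset.Icc 1 (n-1), -(if a = t k then YY n t b y (k+1) - YY n t b y k else 0) := by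
    rw [Finset.sum_comm]
    apply Finset.sum_congr rfl
    intro k hk
    rw [Fin.sum_univ_eq_sum_range (fun c => if a = t k ∧ c = b k then φ a - φ c else 0),
      ← hch k hk]
    rw [Finset.mem_Icc] at hk
    have := h.bound k hk.1 hk.2
    by_cases h1 : a = t k
    · simp [h1, show b k < 6 * n + 2 by omega]
    · simp [h1]
  have c4 : ∑ c : Fin (6*n+2), ∑ k ∈ Finset.Icc 1 (n-1),
        (if (c:ℕ) = t k ∧ a = b k then φ a - φ c else 0)
      = ∑ k ∈ Finset.Icc 1 (n-1), (if a = b k then YY n t b y (k+1) - YY n t b y k else 0) := by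
    rw [Finset.sum_comm]
    apply Finset.sum_congr rfl
    intro k hk
    rw [Fin.sum_univ_eq_sum_range (fun c => if c = t k ∧ a = b k then φ a - φ c else 0),
      ← hch k hk]
    rw [Finset.mem_Icc] at hk
    have := h.bound k hk.1 hk.2
    by_cases h1 : a = b k
    · simp [h1, show t k < 6 * n + 2 by omega]
    · simp [h1]
  have c5 : ∑ k ∈ Finset.Icc 1 (n-1), -(if a = t k then YY n t b y (k+1) - YY n t b y k else 0)
      + ∑ k ∈ Finset.Icc 1 (n-1), (if a = b k then YY n t b y (k+1) - YY n t b y k else 0)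
      = - ∑ k ∈ Finset.Icc 1 (n-1), ((if a = t k then YY n t b y (k+1) - YY n t b y k else 0)
        - (if a = b k then YY n t b y (k+1) - YY n t b y k else 0)) := by
    rw [← Finset.sum_neg_distrib, ← Finset.sum_add_distrib]
    apply Finset.sum_congr rfl
    intros; ring
  rw [c3, c4]
  rcases Nat.eq_zero_or_pos a with h0 | h0
  · subst h0
    have z : ∑ k ∈ Finset.Icc 1 (n-1), ((if 0 = t k then YY n t b y (k+1) - YY n t b y k else 0)
        - (if 0 = b k then YY n t b y (k+1) - YY n t b y k else 0)) = 0 := by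
      apply Finset.sum_eq_zero
      intro k hk
      rw [Finset.mem_Icc] at hk
      have := h.bound k hk.1 hk.2
      rw [if_neg (by omega), if_neg (by omega), sub_zero]
    rw [z] at c5
    rw [if_pos rfl] at c2
    have p1 := hφs 0
    have p2 := hφs (6*n+1)
    rw [hφN] at p2
    rw [psi_eq, h.lab_one _ (by omega)] at p1 p2
    rw [if_neg (by omega : ¬ 6 * n + 1 < y)] at p2
    have e2 : (if 0 = y then (1:ℝ) else 0) = 1 - (if 0 < y then 1 else 0) := by
      split_ifs <;> first | omega | simp
    rw [e2, if_pos rfl]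
    linarith
  · obtain ⟨d, rfl⟩ : ∃ d, a = d + 1 := ⟨a - 1, by omega⟩
    have hd := h.div y d
    rw [if_neg (by omega), Nat.add_sub_cancel] at c2
    rw [if_neg (by omega : ¬ d + 1 = 0)]
    have p1 := hφs d
    have p2 := hφs (d+1)
    linarith

lemma Ch.kirchhoff_eq {n t b} (h : Ch n t b) :
    kirchhoff (cgraph n t b) = (∑ u ∈ Finset.range (6*n+2), ∑ v ∈ Finset.range (6*n+2),
      (SS n t b u u + SS n t b v v - 2 * SS n t b u v)) / 2 := by
  unfold kirchhoff
  congr 1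
  have e : ∀ u v : Fin (6*n+2), resDist (cgraph n t b) u v
      = SS n t b u u + SS n t b v v - 2 * SS n t b u v := by
    intro u v
    apply resDist_of_green (cgraph n t b) (Matrix.of fun x y => SS n t b x y) ⟨0, by omega⟩
    · ext x y; exact SS_symm n t b y x
    · intro x y
      rw [Matrix.mul_apply]
      have := h.green x y y.2
      simp only [Fin.ext_iff, Matrix.of_apply]
      exact this
  simp_rw [e]
  rw [← Fin.sum_univ_eq_sum_range]
  apply Finset.sum_congr rfl
  intro u _
  rw [← Fin.sum_univ_eq_sum_range]

/-! ### Reversal of a block -/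

def gg (u a : ℕ) : ℝ := if a < u then -1 else 1

noncomputable def RR (n : ℕ) (t b : ℕ → ℕ) (u v : ℕ) : ℝ :=
  ∑ a ∈ Finset.range (6*n+2), ∑ c ∈ Finset.range (6*n+2),
    TT n t b a c * ((gg u a * gg v a) * (gg u c * gg v c))

lemma sum_range_chi (N x : ℕ) (hx : x ≤ N) (f : ℕ → ℝ) :
    ∑ a ∈ Finset.range x, f a = ∑ a ∈ Finset.range N, f a * (if a < x then 1 else 0) := by
  simp only [mul_ite, mul_one, mul_zero]
  rw [← Finset.sum_filter]
  apply Finset.sum_congr _ (fun _ _ => rfl)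
  ext a
  simp only [Finset.mem_range, Finset.mem_filter]
  omega

lemma SS_chi (n t b x y) (hx : x ≤ 6*n+2) (hy : y ≤ 6*n+2) :
    SS n t b x y = ∑ a ∈ Finset.range (6*n+2), ∑ c ∈ Finset.range (6*n+2),
      TT n t b a c * ((if a < x then 1 else 0) * (if c < y then 1 else 0)) := by
  unfold SS
  rw [sum_range_chi _ x hx]
  apply Finset.sum_congr rfl
  intro a _
  rw [sum_range_chi _ y hy, Finset.sum_mul]
  apply Finset.sum_congr rfl
  intros; ring

lemma Ch.RR_eq {n t b} (h : Ch n t b) (u v : ℕ) (hu : u < 6*n+2) (hv : v < 6*n+2) :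
    SS n t b u u + SS n t b v v - 2 * SS n t b u v = RR n t b u v / 4 := by
  have e0 : SS n t b u u + SS n t b v v - 2 * SS n t b u v
      = SS n t b u u + SS n t b v v - SS n t b u v - SS n t b v u := by
    rw [SS_symm n t b v u]; ring
  rw [e0, SS_chi n t b u u hu.le hu.le, SS_chi n t b v v hv.le hv.le, SS_chi n t b u v hu.le hv.le,
    SS_chi n t b v u hv.le hu.le]
  have r1 : ∑ a ∈ Finset.range (6*n+2), ∑ c ∈ Finset.range (6*n+2),
      TT n t b a c * (gg u a * gg v a) = 0 := by
    apply Finset.sum_eq_zero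
    intro a ha
    rw [← Finset.sum_mul]
    simp_rw [TT_symm n t b a]
    rw [h.TT_row a (Finset.mem_range.1 ha), zero_mul]
  have r2 : ∑ a ∈ Finset.range (6*n+2), ∑ c ∈ Finset.range (6*n+2),
      TT n t b a c * (gg u c * gg v c) = 0 := by
    rw [Finset.sum_comm]
    apply Finset.sum_eq_zero
    intro a ha
    rw [← Finset.sum_mul]
    rw [h.TT_row a (Finset.mem_range.1 ha), zero_mul]
  have r3 : ∑ a ∈ Finset.range (6*n+2), ∑ c ∈ Finset.range (6*n+2),
      TT n t b a c = 0 := by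
    rw [Finset.sum_comm]
    apply Finset.sum_eq_zero
    intro a ha
    rw [h.TT_row a (Finset.mem_range.1 ha)]
  have r4 : RR n t b u v = RR n t b u v
      + (∑ a ∈ Finset.range (6*n+2), ∑ c ∈ Finset.range (6*n+2), TT n t b a c)
      - (∑ a ∈ Finset.range (6*n+2), ∑ c ∈ Finset.range (6*n+2), TT n t b a c * (gg u a * gg v a))
      - (∑ a ∈ Finset.range (6*n+2), ∑ c ∈ Finset.range (6*n+2), TT n t b a c * (gg u c * gg v c)) := by
    rw [r1, r2, r3]; ring
  rw [r4, RR]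
  simp only [← Finset.sum_add_distrib, ← Finset.sum_sub_distrib, Finset.sum_div]
  apply Finset.sum_congr rfl
  intro a _
  apply Finset.sum_congr rfl
  intro c _
  have key : ((if a < u then (1:ℝ) else 0) - (if a < v then 1 else 0)) *
      ((if c < u then 1 else 0) - (if c < v then 1 else 0))
      = (1 - gg u a * gg v a) * (1 - gg u c * gg v c) / 4 := by
    unfold gg
    split_ifs <;> first | (exfalso; omega) | norm_num
  linear_combination (TT n t b a c) * key

lemma Ch.kirchhoff_RR {n t b} (h : Ch n t b) :
    8 * kirchhoff (cgraph n t b) = ∑ u ∈ Finset.range (6*n+2), ∑ v ∈ Finset.range (6*n+2),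
      RR n t b u v := by
  rw [h.kirchhoff_eq]
  have : ∑ u ∈ Finset.range (6*n+2), ∑ v ∈ Finset.range (6*n+2),
      (SS n t b u u + SS n t b v v - 2 * SS n t b u v)
      = (∑ u ∈ Finset.range (6*n+2), ∑ v ∈ Finset.range (6*n+2), RR n t b u v) / 4 := by
    simp only [Finset.sum_div]
    apply Finset.sum_congr rfl
    intro u hu
    apply Finset.sum_congr rfl
    intro v hv
    exact h.RR_eq u v (Finset.mem_range.1 hu) (Finset.mem_range.1 hv)
  rw [this]; ring

def tau (s e a : ℕ) : ℕ := if s ≤ a ∧ a < e then s + e - 1 - a else a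
def sig (s e v : ℕ) : ℕ := if s < v ∧ v < e then s + e - v else v
def IE (s e a : ℕ) : ℝ := if s ≤ a ∧ a < e then 1 else 0
def IV (s e v : ℕ) : ℝ := if s < v ∧ v < e then 1 else 0

lemma tau_tau (s e a : ℕ) : tau s e (tau s e a) = a := by
  unfold tau; split_ifs <;> omega

lemma sig_sig (s e a : ℕ) : sig s e (sig s e a) = a := by
  unfold sig; split_ifs <;> omega

lemma sum_tau (s e N : ℕ) (he : e ≤ N) (f : ℕ → ℝ) :
    ∑ a ∈ Finset.range N, f (tau s e a) = ∑ a ∈ Finset.range N, f a := by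
  have hm : ∀ a ∈ Finset.range N, tau s e a ∈ Finset.range N := by
    intro a ha
    rw [Finset.mem_range] at *
    unfold tau; split_ifs <;> omega
  exact Finset.sum_nbij' (tau s e) (tau s e) hm hm (fun a _ => tau_tau s e a)
    (fun a _ => tau_tau s e a) (fun _ _ => rfl)

lemma sum_sig (s e N : ℕ) (he : e ≤ N) (f : ℕ → ℝ) :
    ∑ a ∈ Finset.range N, f (sig s e a) = ∑ a ∈ Finset.range N, f a := by
  have hm : ∀ a ∈ Finset.range N, sig s e a ∈ Finset.range N := by
    intro a ha
    rw [Finset.mem_range] at *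
    unfold sig; split_ifs <;> omega
  exact Finset.sum_nbij' (sig s e) (sig s e) hm hm (fun a _ => sig_sig s e a)
    (fun a _ => sig_sig s e a) (fun _ _ => rfl)

lemma gg_sig (s e u a : ℕ) :
    gg (sig s e u) (tau s e a) = gg u a * (1 - 2 * IV s e u * IE s e a) := by
  unfold gg sig tau IV IE
  split_ifs <;> first | (exfalso; omega) | norm_num

/-- the coefficient of the outside part -/
def KX (s e u a : ℕ) : ℝ :=
  2 * (if a < u then 1 else 0) - (if a < s then 1 else 0) - (if a < e then 1 else 0)
    + (if u ≤ s then 1 else -1)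

def KY (s e v c : ℕ) : ℝ :=
  (if c < s then 1 else 0) + (if c < e then 1 else 0) - 2 * (if c < v then 1 else 0)

noncomputable def FF (n : ℕ) (t b : ℕ → ℕ) (s e u v a c : ℕ) : ℝ :=
  TT n t b a c * ((gg u a * gg v a) * (gg u c * gg v c)) *
    ((1 - IV s e u) * IV s e v * (1 - IE s e a) * IE s e c)

lemma IE_or (s e a) : IE s e a = 0 ∨ IE s e a = 1 := by
  unfold IE; split_ifs <;> simp

lemma IV_or (s e a) : IV s e a = 0 ∨ IV s e a = 1 := by
  unfold IV; split_ifs <;> simp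

lemma RR_diff (n t b t' b' s e u v) (he : e ≤ 6*n+2)
    (hlab : ∀ a, lab n t' b' a = lab n t b (tau s e a)) :
    RR n t b u v - RR n t' b' (sig s e u) (sig s e v)
      = ∑ a ∈ Finset.range (6*n+2), ∑ c ∈ Finset.range (6*n+2),
        2 * (FF n t b s e u v a c + FF n t b s e v u a c + FF n t b s e u v c a
          + FF n t b s e v u c a) := by
  have hT : ∀ a c, TT n t' b' a c = TT n t b (tau s e a) (tau s e c) := by
    intro a c
    unfold TT
    rw [hlab, hlab]
    congr 1
    have : a = c ↔ tau s e a = tau s e c :=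
      ⟨fun h => by rw [h], fun h => by rw [← tau_tau s e a, h, tau_tau]⟩
    simp only [this]
  have e1 : RR n t' b' (sig s e u) (sig s e v)
      = ∑ a ∈ Finset.range (6*n+2), ∑ c ∈ Finset.range (6*n+2), TT n t b a c *
        ((gg (sig s e u) (tau s e a) * gg (sig s e v) (tau s e a)) *
          (gg (sig s e u) (tau s e c) * gg (sig s e v) (tau s e c))) := by
    unfold RR
    rw [← sum_tau s e _ he]
    apply Finset.sum_congr rfl
    intro a _
    rw [← sum_tau s e _ he]
    apply Finset.sum_congr rfl
    intro c _
    rw [hT, tau_tau, tau_tau]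
  rw [e1, RR, ← Finset.sum_sub_distrib]
  apply Finset.sum_congr rfl
  intro a _
  rw [← Finset.sum_sub_distrib]
  apply Finset.sum_congr rfl
  intro c _
  simp only [gg_sig, FF]
  rw [TT_symm n t b c a]
  rcases IE_or s e a with h1 | h1 <;> rcases IE_or s e c with h2 | h2 <;>
    rcases IV_or s e u with h3 | h3 <;> rcases IV_or s e v with h4 | h4 <;>
    rw [h1, h2, h3, h4] <;> ring

lemma FF_eq {n t b} {m s e : ℕ} (u v a c : ℕ) (hmu : MM n m m ≠ 0)
    (hout : ¬ (s ≤ a ∧ a < e) → lab n t b a ≤ m)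
    (hin : (s ≤ c ∧ c < e) → m ≤ lab n t b c) :
    FF n t b s e u v a c = -(MM n m m)⁻¹ *
      (((1 - IV s e u) * (MM n (lab n t b a) m * KX s e u a)) *
        (IV s e v * (MM n (lab n t b c) m * KY s e v c))) := by
  unfold FF
  by_cases hu : s < u ∧ u < e
  · simp [IV, hu]
  by_cases hv : s < v ∧ v < e
  swap
  · simp [IV, hv]
  have k1 : ∀ a, (s ≤ a ∧ a < e) → KX s e u a = 0 := by
    intro a ha
    unfold KX
    split_ifs <;> first | (exfalso; omega) | norm_num
  have k2 : ∀ c, ¬ (s ≤ c ∧ c < e) → KY s e v c = 0 := by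
    intro a ha
    unfold KY
    split_ifs <;> first | (exfalso; omega) | norm_num
  by_cases ha : s ≤ a ∧ a < e
  · rw [k1 a ha]; simp [IE, ha]
  by_cases hc : s ≤ c ∧ c < e
  swap
  · rw [k2 c hc]; simp [IE, hc]
  have hac : a ≠ c := by rintro rfl; exact ha hc
  have hT : TT n t b a c = -(MM n m m)⁻¹ * (MM n (lab n t b a) m * MM n (lab n t b c) m) := by
    rw [← MM_rank n _ m _ (hout ha) (hin hc)]
    unfold TT
    rw [if_neg hac]
    field_simp
    ring
  have x1 : gg u a * gg v a * gg u c = KX s e u a := by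
    unfold gg KX
    split_ifs <;> first | (exfalso; omega) | norm_num
  have x2 : gg v c = KY s e v c := by
    unfold gg KY
    split_ifs <;> first | (exfalso; omega) | norm_num
  rw [hT, ← x1, ← x2]
  simp only [IV, IE, hu, hv, ha, hc, and_self, if_true, if_false]
  ring

/-- prefix sums -/
noncomputable def VP (n : ℕ) (t b : ℕ → ℕ) (m x : ℕ) : ℝ :=
  ∑ a ∈ Finset.range x, MM n (lab n t b a) m

lemma sum4_factor (N : ℕ) (r : ℝ) (A B : ℕ → ℕ → ℝ) :
    ∑ u ∈ Finset.range N, ∑ v ∈ Finset.range N, ∑ a ∈ Finset.range N, ∑ c ∈ Finset.range N,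
      r * (A u a * B v c) = r * ((∑ u ∈ Finset.range N, ∑ a ∈ Finset.range N, A u a) *
        (∑ v ∈ Finset.range N, ∑ c ∈ Finset.range N, B v c)) := by
  rw [Finset.sum_mul_sum, Finset.mul_sum]
  apply Finset.sum_congr rfl
  intro u _
  rw [Finset.mul_sum]
  apply Finset.sum_congr rfl
  intro v _
  rw [Finset.sum_mul_sum, Finset.mul_sum]
  apply Finset.sum_congr rfl
  intro a _
  rw [Finset.mul_sum]

lemma kirchhoff_diff {n t b t' b'} (h : Ch n t b) (h' : Ch n t' b') (m s e : ℕ)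
    (hmu : MM n m m ≠ 0) (hse : s ≤ e) (he : e ≤ 6*n+2)
    (hlab : ∀ a, lab n t' b' a = lab n t b (tau s e a))
    (hout : ∀ a, ¬ (s ≤ a ∧ a < e) → lab n t b a ≤ m)
    (hin : ∀ a, (s ≤ a ∧ a < e) → m ≤ lab n t b a) :
    kirchhoff (cgraph n t b) - kirchhoff (cgraph n t' b') = -(MM n m m)⁻¹ *
      ((∑ u ∈ Finset.range (6*n+2), (1 - IV s e u) *
          (2 * VP n t b m u - VP n t b m s - VP n t b m e
            + (if u ≤ s then 1 else -1) * VP n t b m (6*n+2))) *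
       (∑ v ∈ Finset.range (6*n+2), IV s e v *
          (VP n t b m s + VP n t b m e - 2 * VP n t b m v))) := by
  have d1 : 8 * (kirchhoff (cgraph n t b) - kirchhoff (cgraph n t' b'))
      = ∑ u ∈ Finset.range (6*n+2), ∑ v ∈ Finset.range (6*n+2),
        (RR n t b u v - RR n t' b' (sig s e u) (sig s e v)) := by
    rw [mul_sub, h.kirchhoff_RR, h'.kirchhoff_RR]
    rw [← sum_sig s e _ he (fun u => ∑ v ∈ Finset.range (6*n+2), RR n t' b' u v),
      ← Finset.sum_sub_distrib]
    apply Finset.sum_congr rfl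
    intro u _
    rw [← sum_sig s e _ he (fun v => RR n t' b' (sig s e u) v), ← Finset.sum_sub_distrib]
  set N := 6 * n + 2 with hN
  have d2 : 8 * (kirchhoff (cgraph n t b) - kirchhoff (cgraph n t' b'))
      = 8 * ∑ u ∈ Finset.range N, ∑ v ∈ Finset.range N, ∑ a ∈ Finset.range N,
        ∑ c ∈ Finset.range N, FF n t b s e u v a c := by
    rw [d1]
    simp_rw [fun u v => RR_diff n t b t' b' s e u v he hlab]
    simp only [← hN, ← Finset.mul_sum, Finset.sum_add_distrib]
    have s1 : ∑ u ∈ Finset.range N, ∑ v ∈ Finset.range N, ∑ a ∈ Finset.range N,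
        ∑ c ∈ Finset.range N, FF n t b s e v u a c = ∑ u ∈ Finset.range N, ∑ v ∈ Finset.range N,
        ∑ a ∈ Finset.range N, ∑ c ∈ Finset.range N, FF n t b s e u v a c := Finset.sum_comm
    have s2 : ∀ u v, ∑ a ∈ Finset.range N, ∑ c ∈ Finset.range N, FF n t b s e u v c a
        = ∑ a ∈ Finset.range N, ∑ c ∈ Finset.range N, FF n t b s e u v a c :=
      fun u v => Finset.sum_comm
    simp_rw [s2]
    rw [s1]
    ring
  have d3 : kirchhoff (cgraph n t b) - kirchhoff (cgraph n t' b')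
      = ∑ u ∈ Finset.range N, ∑ v ∈ Finset.range N, ∑ a ∈ Finset.range N,
        ∑ c ∈ Finset.range N, FF n t b s e u v a c := by linarith
  rw [d3]
  simp_rw [fun u v a c => FF_eq (n := n) (t := t) (b := b) (m := m) (s := s) (e := e) u v a c hmu
    (hout a) (hin c)]
  rw [sum4_factor N _ (fun u a => (1 - IV s e u) * (MM n (lab n t b a) m * KX s e u a))
    (fun v c => IV s e v * (MM n (lab n t b c) m * KY s e v c))]
  have hV : ∀ x, x ≤ N → VP n t b m x = ∑ a ∈ Finset.range N, MM n (lab n t b a) m *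
      (if a < x then 1 else 0) := fun x hx => sum_range_chi N x hx _
  have hVN : VP n t b m N = ∑ a ∈ Finset.range N, MM n (lab n t b a) m := rfl
  congr 2
  · apply Finset.sum_congr rfl
    intro u hu
    rw [Finset.mem_range] at hu
    rw [← Finset.mul_sum]
    congr 1
    rw [hV u hu.le, hV s (by omega), hV e he, hVN]
    simp only [Finset.mul_sum, ← Finset.sum_sub_distrib, ← Finset.sum_add_distrib]
    apply Finset.sum_congr rfl
    intro a _
    unfold KX
    ring
  · apply Finset.sum_congr rfl
    intro u hu
    rw [Finset.mem_range] at hu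
    rw [← Finset.mul_sum]
    congr 1
    rw [hV u hu.le, hV s (by omega), hV e he]
    simp only [Finset.mul_sum, ← Finset.sum_sub_distrib, ← Finset.sum_add_distrib]
    apply Finset.sum_congr rfl
    intro a _
    unfold KY
    ring

lemma six_split (f : ℕ → ℝ) (N s e : ℕ) (hs : 3 ≤ s) (hse : s < e) (heN : e + 3 ≤ N)
    (hz : ∀ u, s < u → u < e → f u = 0)
    (h0 : f s + f e = 0) (h1 : f (s - 1) + f (e + 1) = 0) (h2 : f (s - 2) + f (e + 2) = 0)
    (hl : ∀ u, u < s - 2 → 0 < f u) (hr : ∀ u, e + 3 ≤ u → u < N → 0 < f u) :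
    0 < ∑ u ∈ Finset.range N, f u := by
  obtain ⟨q, rfl⟩ : ∃ q, s = q + 2 := ⟨s - 2, by omega⟩
  have e1 : ∑ u ∈ Finset.range N, f u = ∑ u ∈ Finset.range q, f u + ∑ u ∈ Finset.Ico q N, f u := by
    rw [Finset.range_eq_Ico, Finset.range_eq_Ico, Finset.sum_Ico_consecutive] <;> omega
  have e2 : ∑ u ∈ Finset.Ico q N, f u = f q + (f (q+1) + (f (q+2) + ∑ u ∈ Finset.Ico (q+3) N, f u)) := by
    rw [Finset.sum_eq_sum_Ico_succ_bot (by omega), Finset.sum_eq_sum_Ico_succ_bot (by omega),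
      Finset.sum_eq_sum_Ico_succ_bot (by omega)]
  have e3 : ∑ u ∈ Finset.Ico (q+3) N, f u = ∑ u ∈ Finset.Ico (q+3) e, f u + ∑ u ∈ Finset.Ico e N, f u := by
    rw [Finset.sum_Ico_consecutive] <;> omega
  have e4 : ∑ u ∈ Finset.Ico e N, f u = f e + (f (e+1) + (f (e+2) + ∑ u ∈ Finset.Ico (e+3) N, f u)) := by
    rw [Finset.sum_eq_sum_Ico_succ_bot (by omega), Finset.sum_eq_sum_Ico_succ_bot (by omega),
      Finset.sum_eq_sum_Ico_succ_bot (by omega)]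
  have e5 : ∑ u ∈ Finset.Ico (q+3) e, f u = 0 := by
    apply Finset.sum_eq_zero
    intro u hu
    rw [Finset.mem_Ico] at hu
    exact hz u (by omega) (by omega)
  have e6 : 0 ≤ ∑ u ∈ Finset.Ico (e+3) N, f u := by
    apply Finset.sum_nonneg
    intro u hu
    rw [Finset.mem_Ico] at hu
    exact (hr u (by omega) (by omega)).le
  have e7 : 0 < ∑ u ∈ Finset.range q, f u := by
    apply Finset.sum_pos
    · intro u hu
      rw [Finset.mem_range] at hu
      exact hl u (by omega)
    · exact ⟨0, by rw [Finset.mem_range]; omega⟩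
  have a1 : q + 2 - 1 = q + 1 := by omega
  have a2 : q + 2 - 2 = q := by omega
  rw [a1] at h1
  rw [a2] at h2
  linarith

lemma XY_case1 (V : ℕ → ℝ) (N p s e : ℕ) (μ ν ρ : ℝ) (hp : 1 ≤ p) (hs : s = p + 2)
    (hse : s + 1 < e) (heN : e + 3 ≤ N) (hV : Monotone V) (hV0 : 0 ≤ V 0) (hN : V N = 1)
    (hν : 0 < ν) (hρ : 0 < ρ)
    (l1 : V (p+1) = V p + μ) (l2 : V (p+2) = V p + 2 * μ)
    (r0 : V (e - 1) = V s + μ - ν) (r1 : V e = V (e - 1) + μ) (r2 : V (e+1) = V e + μ)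
    (r3 : V (e+2) = V e + 2 * μ) (r4 : V (e+3) = V e + 3 * μ)
    (hr : 8 * μ = 1 + ν + ρ) :
    0 < (∑ u ∈ Finset.range N, (1 - IV s e u) *
          (2 * V u - V s - V e + (if u ≤ s then 1 else -1) * V N)) *
       (∑ v ∈ Finset.range N, IV s e v * (V s + V e - 2 * V v)) := by
  subst hs
  have hb : V (e+3) ≤ 1 := by rw [← hN]; exact hV heN
  have hV0' : 0 ≤ V p := hV0.trans (hV (by omega))
  apply mul_pos
  · apply six_split _ N (p+2) e (by omega) (by omega) heN
    · intro u h1 h2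
      simp [IV, h1, h2]
    · simp only [IV, hN, lt_irrefl, false_and, and_false, if_false, le_refl, if_true,
        if_neg (show ¬ e ≤ p + 2 by omega)]
      ring
    · have a1 : p + 2 - 1 = p + 1 := by omega
      rw [a1]
      simp only [IV, hN, if_neg (show ¬ (p + 2 < p + 1 ∧ p + 1 < e) by omega),
        if_neg (show ¬ (p + 2 < e + 1 ∧ e + 1 < e) by omega),
        if_pos (show p + 1 ≤ p + 2 by omega), if_neg (show ¬ e + 1 ≤ p + 2 by omega)]
      linarith
    · have a1 : p + 2 - 2 = p := by omega
      rw [a1]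
      simp only [IV, hN, if_neg (show ¬ (p + 2 < p ∧ p < e) by omega),
        if_neg (show ¬ (p + 2 < e + 2 ∧ e + 2 < e) by omega),
        if_pos (show p ≤ p + 2 by omega), if_neg (show ¬ e + 2 ≤ p + 2 by omega)]
      linarith
    · intro u hu
      simp only [IV, hN, if_neg (show ¬ (p + 2 < u ∧ u < e) by omega),
        if_pos (show u ≤ p + 2 by omega)]
      have : 0 ≤ V u := hV0.trans (hV (by omega))
      linarith
    · intro u hu _
      simp only [IV, hN, if_neg (show ¬ (p + 2 < u ∧ u < e) by omega),
        if_neg (show ¬ u ≤ p + 2 by omega)]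
      have : V (e+3) ≤ V u := hV hu
      linarith
  · apply Finset.sum_pos'
    · intro v _
      unfold IV
      split_ifs with hv
      · have : V v ≤ V (e - 1) := hV (by omega)
        linarith
      · linarith
    · refine ⟨p + 3, by rw [Finset.mem_range]; omega, ?_⟩
      unfold IV
      rw [if_pos (by omega)]
      have : V (p + 3) ≤ V (e - 1) := hV (by omega)
      linarith

lemma XY_case3 (V : ℕ → ℝ) (N p s e : ℕ) (μ ν ρ : ℝ) (hs : s = p + 3)
    (hse : s + 1 < e) (heN : e + 3 ≤ N) (hV : Monotone V) (hV0 : 0 ≤ V 0) (hN : V N = 1)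
    (hν : 0 < ν) (hρ : 0 < ρ)
    (l1 : V (p+1) = V p + μ) (l2 : V (p+2) = V p + 2 * μ) (l3 : V (p+3) = V p + 3 * μ)
    (l4 : V (p+4) = V p + 4 * μ)
    (r0 : V e = V (p+4) + μ - ν) (r2 : V (e+1) = V e + μ)
    (r3 : V (e+2) = V e + 2 * μ)
    (hr : 8 * μ = 1 + ν + ρ) :
    0 < (∑ u ∈ Finset.range N, (1 - IV s e u) *
          (2 * V u - V s - V e + (if u ≤ s then 1 else -1) * V N)) *
       (∑ v ∈ Finset.range N, IV s e v * (V s + V e - 2 * V v)) := by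
  subst hs
  have hV0' : 0 ≤ V p := hV0.trans (hV (by omega))
  rw [← neg_mul_neg, ← Finset.sum_neg_distrib, ← Finset.sum_neg_distrib]
  apply mul_pos
  · apply six_split _ N (p+3) e (by omega) (by omega) heN
    · intro u h1 h2
      simp [IV, h1, h2]
    · simp only [IV, hN, lt_irrefl, false_and, and_false, if_false, le_refl, if_true,
        if_neg (show ¬ e ≤ p + 3 by omega)]
      ring
    · have a1 : p + 3 - 1 = p + 2 := by omega
      rw [a1]
      simp only [IV, hN, if_neg (show ¬ (p + 3 < p + 2 ∧ p + 2 < e) by omega),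
        if_neg (show ¬ (p + 3 < e + 1 ∧ e + 1 < e) by omega),
        if_pos (show p + 2 ≤ p + 3 by omega), if_neg (show ¬ e + 1 ≤ p + 3 by omega)]
      linarith
    · have a1 : p + 3 - 2 = p + 1 := by omega
      rw [a1]
      simp only [IV, hN, if_neg (show ¬ (p + 3 < p + 1 ∧ p + 1 < e) by omega),
        if_neg (show ¬ (p + 3 < e + 2 ∧ e + 2 < e) by omega),
        if_pos (show p + 1 ≤ p + 3 by omega), if_neg (show ¬ e + 2 ≤ p + 3 by omega)]
      linarith
    · intro u hu
      simp only [IV, hN, if_neg (show ¬ (p + 3 < u ∧ u < e) by omega),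
        if_pos (show u ≤ p + 3 by omega)]
      have : V u ≤ V p := hV (by omega)
      linarith
    · intro u hu hu2
      simp only [IV, hN, if_neg (show ¬ (p + 3 < u ∧ u < e) by omega),
        if_neg (show ¬ u ≤ p + 3 by omega)]
      have : V u ≤ V N := hV hu2.le
      linarith
  · apply Finset.sum_pos'
    · intro v _
      unfold IV
      split_ifs with hv
      · have : V (p+4) ≤ V v := hV (by omega)
        linarith
      · linarith
    · refine ⟨p + 4, by rw [Finset.mem_range]; omega, ?_⟩
      unfold IV
      rw [if_pos (by omega)]
      linarith

lemma VP_succ (n : ℕ) (t b : ℕ → ℕ) (m x : ℕ) :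
    VP n t b m (x+1) = VP n t b m x + MM n (lab n t b x) m := by
  unfold VP
  rw [Finset.sum_range_succ]

lemma VP_mono (n : ℕ) (t b : ℕ → ℕ) (m : ℕ) (hn : 1 ≤ n) (h1 : 1 ≤ m) (h2 : m ≤ n) :
    Monotone (VP n t b m) := by
  apply monotone_nat_of_le_succ
  intro x
  rw [VP_succ]
  have := MM_pos n (lab n t b x) m (lab_pos n t b x) h1 (lab_le n hn t b x) h2
  linarith

lemma VP_sub (n : ℕ) (t b : ℕ → ℕ) (m x y : ℕ) (hxy : x ≤ y) :
    VP n t b m y - VP n t b m x = ∑ a ∈ Finset.Ico x y, MM n (lab n t b a) m := by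
  unfold VP
  rw [Finset.sum_Ico_eq_sub _ hxy]

lemma core {n t b t' b'} (h : Ch n t b) (h' : Ch n t' b') (k : ℕ) (hk : 1 ≤ k) (hkn : k + 1 ≤ n - 1)
    (hc : (t (k+1) = t k + 2 ∧ b k = b (k+1) + 4) ∨ (t (k+1) = t k + 4 ∧ b k = b (k+1) + 2))
    (s e : ℕ) (hs : s = if t (k+1) = t k + 2 then t k + 2 else t k + 3)
    (he : e = if t (k+1) = t k + 2 then b (k+1) + 1 else b (k+1))
    (ht1 : ∀ j, 1 ≤ j → j ≤ k → t' j = t j)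
    (hb1 : ∀ j, 1 ≤ j → j ≤ k → b' j = b j)
    (ht2 : ∀ j, k < j → j ≤ n - 1 → t' j + b j = s + e)
    (hb2 : ∀ j, k < j → j ≤ n - 1 → b' j + t j = s + e) :
    kirchhoff (cgraph n t b) < kirchhoff (cgraph n t' b') := by
  have hn := h.hn
  have bk := h.bound k hk (by omega)
  have bm := h.bound (k+1) (by omega) (by omega)
  have hmono := VP_mono n t b (k+1) (by omega) (by omega) (by omega)
  have hmu := MM_pos n (k+1) (k+1) (by omega) (by omega) (by omega) (by omega)
  have hrho := MM_pos n k (k+1) (by omega) (by omega) (by omega) (by omega)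
  have hnu := MM_pos n (k+2) (k+1) (by omega) (by omega) (by omega) (by omega)
  have hall : VP n t b (k+1) (6*n+2) = 1 := h.sum_all (k+1) (by omega) (by omega)
  have hV0 : 0 ≤ VP n t b (k+1) 0 := by simp [VP]
  have hstep : ∀ a, (t k ≤ a ∧ a < b k) → ¬ (t (k+1) ≤ a ∧ a < b (k+1)) →
      VP n t b (k+1) (a+1) = VP n t b (k+1) a + MM n (k+1) (k+1) := by
    intro a h1 h2
    rw [VP_succ, h.lab_eq k a hk hkn h1 h2]
  have arcm : VP n t b (k+1) (b (k+1)) = VP n t b (k+1) (t (k+1)) + MM n (k+1) (k+1)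
      - MM n (k+2) (k+1) := by
    have h1 := VP_sub n t b (k+1) (t (k+1)) (b (k+1)) (by omega)
    rw [h.sum_arc (k+1) (by omega) (by omega) (k+1) (by omega) (by omega), if_neg (lt_irrefl _)] at h1
    linarith
  have arck : VP n t b (k+1) (b k) = VP n t b (k+1) (t k) + 1 - MM n (k+1) (k+1)
      + MM n k (k+1) := by
    have h1 := VP_sub n t b (k+1) (t k) (b k) (by omega)
    rw [h.sum_arc (k+1) (by omega) (by omega) k (by omega) (by omega), if_pos (by omega)] at h1
    linarith
  have hlt : t k + 2 ≤ s ∧ s ≤ t (k+1) ∧ b (k+1) ≤ e ∧ e + 2 ≤ b k := by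
    rcases hc with hc | hc
    · rw [if_pos hc.1] at hs he; omega
    · rw [if_neg (by omega)] at hs he; omega
  have hlab : ∀ a, lab n t' b' a = lab n t b (tau s e a) := by
    intro a
    unfold lab
    congr 2
    apply Finset.filter_congr
    intro j hj
    rw [Finset.mem_Icc] at hj
    rcases Nat.lt_or_ge k j with hkj | hkj
    · have h1 := ht2 j hkj hj.2
      have h2 := hb2 j hkj hj.2
      have h3 : t (k+1) ≤ t j ∧ b j ≤ b (k+1) := by
        rcases Nat.lt_or_ge (k+1) j with h4 | h4
        · have := h.lt (k+1) j (by omega) h4 hj.2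
          omega
        · have : j = k + 1 := by omega
          subst this; exact ⟨le_refl _, le_refl _⟩
      have h5 := h.bound j hj.1 hj.2
      unfold tau
      split_ifs <;> omega
    · rw [ht1 j hj.1 hkj, hb1 j hj.1 hkj]
      have h3 : t j ≤ t k ∧ b k ≤ b j := by
        rcases Nat.lt_or_ge j k with h4 | h4
        · have := h.lt j k hj.1 h4 (by omega)
          omega
        · have : j = k := by omega
          subst this; exact ⟨le_refl _, le_refl _⟩
      unfold tau
      split_ifs <;> omega
  have hout : ∀ a, ¬ (s ≤ a ∧ a < e) → lab n t b a ≤ k+1 := by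
    intro a ha
    by_contra hcon
    have := (h.lab_gt (k+1) a (by omega) (by omega)).1 (by omega)
    omega
  have hin : ∀ a, (s ≤ a ∧ a < e) → k+1 ≤ lab n t b a := by
    intro a ha
    have := (h.lab_gt k a (by omega) (by omega)).2 (by omega)
    omega
  have hd := kirchhoff_diff h h' (k+1) s e hmu.ne' (by omega) (by omega) hlab hout hin
  have hpos : 0 < (∑ u ∈ Finset.range (6*n+2), (1 - IV s e u) *
          (2 * VP n t b (k+1) u - VP n t b (k+1) s - VP n t b (k+1) e
            + (if u ≤ s then 1 else -1) * VP n t b (k+1) (6*n+2))) *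
       (∑ v ∈ Finset.range (6*n+2), IV s e v *
          (VP n t b (k+1) s + VP n t b (k+1) e - 2 * VP n t b (k+1) v)) := by
    have s1 := hstep (t k) (by omega) (by omega)
    have s2 := hstep (t k + 1) (by omega) (by omega)
    have q1 := hstep (b (k+1)) (by omega) (by omega)
    have q2 := hstep (b (k+1) + 1) (by omega) (by omega)
    rw [show t k + 1 + 1 = t k + 2 by ring] at s2
    rw [show b (k+1) + 1 + 1 = b (k+1) + 2 by ring] at q2
    rcases hc with hc | hc
    · rw [if_pos hc.1] at hs he
      have q3 := hstep (b (k+1) + 2) (by omega) (by omega)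
      have q4 := hstep (b (k+1) + 3) (by omega) (by omega)
      rw [show b (k+1) + 2 + 1 = b (k+1) + 3 by ring] at q3
      rw [show b (k+1) + 3 + 1 = b (k+1) + 4 by ring] at q4
      rw [hc.2] at arck
      rw [hc.1] at arcm
      have he1 : e - 1 = b (k+1) := by omega
      have he2 : e + 1 = b (k+1) + 2 := by omega
      have he3 : e + 2 = b (k+1) + 3 := by omega
      have he4 : e + 3 = b (k+1) + 4 := by omega
      refine XY_case1 (VP n t b (k+1)) (6*n+2) (t k) s e (MM n (k+1) (k+1)) (MM n (k+2) (k+1))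
        (MM n k (k+1)) bk.1 hs (by omega) (by omega) hmono hV0 hall hnu hrho s1 ?_ ?_ ?_ ?_ ?_ ?_ ?_
      · linarith
      · rw [he1, hs]; exact arcm
      · rw [he1, he]; exact q1
      · rw [he2, he]; exact q2
      · rw [he3, he]; linarith
      · rw [he4, he]; linarith
      · linarith
    · rw [if_neg (by omega)] at hs he
      have s3 := hstep (t k + 2) (by omega) (by omega)
      have s4 := hstep (t k + 3) (by omega) (by omega)
      rw [show t k + 2 + 1 = t k + 3 by ring] at s3
      rw [show t k + 3 + 1 = t k + 4 by ring] at s4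
      rw [hc.2] at arck
      rw [hc.1] at arcm
      refine XY_case3 (VP n t b (k+1)) (6*n+2) (t k) s e (MM n (k+1) (k+1)) (MM n (k+2) (k+1))
        (MM n k (k+1)) hs (by omega) (by omega) hmono hV0 hall hnu hrho s1 ?_ ?_ ?_ ?_ ?_ ?_ ?_
      · linarith
      · linarith
      · linarith
      · rw [he]; exact arcm
      · rw [he]; exact q1
      · rw [he]; linarith
      · linarith
  have := mul_pos (inv_pos.2 hmu) hpos
  rw [neg_mul] at hd
  linarith

lemma tpos_succ (n : ℕ) (w : Fin (n - 2) → Fin 5) (j : Fin (n-2)) :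
    tpos n w ((j:ℕ) + 2) = tpos n w ((j:ℕ)+1) + 1 + (w j : ℕ) := by
  unfold tpos
  have : (Finset.univ.filter (fun l : Fin (n - 2) => (l : ℕ) + 1 < (j:ℕ) + 2))
      = insert j (Finset.univ.filter (fun l : Fin (n - 2) => (l : ℕ) + 1 < (j:ℕ) + 1)) := by
    ext l
    simp only [Finset.mem_filter, Finset.mem_univ, true_and, Finset.mem_insert, Fin.ext_iff]
    omega
  rw [this, Finset.sum_insert (by simp)]
  omega

lemma bpos_succ (n : ℕ) (w : Fin (n - 2) → Fin 5) (j : Fin (n-2)) :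
    bpos n w ((j:ℕ) + 1) = bpos n w ((j:ℕ)+2) + (5 - (w j : ℕ)) := by
  unfold bpos
  have : (Finset.univ.filter (fun l : Fin (n - 2) => (j:ℕ) + 1 ≤ (l : ℕ) + 1))
      = insert j (Finset.univ.filter (fun l : Fin (n - 2) => (j:ℕ) + 2 ≤ (l : ℕ) + 1)) := by
    ext l
    simp only [Finset.mem_filter, Finset.mem_univ, true_and, Finset.mem_insert, Fin.ext_iff]
    omega
  rw [this, Finset.sum_insert (by simp)]
  omega

lemma ch_oct (n : ℕ) (hn : 3 ≤ n) (w : Fin (n - 2) → Fin 5) : Ch n (tpos n w) (bpos n w) where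
  hn := hn
  t1 := by simp [tpos]
  last := by
    unfold tpos bpos
    have h1 : (Finset.univ.filter (fun l : Fin (n - 2) => n - 1 ≤ (l : ℕ) + 1)) = ∅ := by
      ext l
      have := l.2
      simp only [Finset.mem_filter, Finset.mem_univ, true_and, Finset.notMem_empty, iff_false]
      omega
    have h2 : (Finset.univ.filter (fun l : Fin (n - 2) => (l : ℕ) + 1 < n - 1)) = Finset.univ := by
      ext l
      have := l.2
      simp only [Finset.mem_filter, Finset.mem_univ, true_and, iff_true]
      omega
    rw [h1, h2, Finset.sum_empty]
    omega
  stepT := by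
    intro k h1 h2
    obtain ⟨j, rfl⟩ : ∃ j : Fin (n-2), k = (j:ℕ) + 1 := ⟨⟨k - 1, by omega⟩, by simp; omega⟩
    have := tpos_succ n w j
    show tpos n w ((j:ℕ)+1) < tpos n w ((j:ℕ)+2)
    omega
  stepB := by
    intro k h1 h2
    obtain ⟨j, rfl⟩ : ∃ j : Fin (n-2), k = (j:ℕ) + 1 := ⟨⟨k - 1, by omega⟩, by simp; omega⟩
    have := bpos_succ n w j
    have := (w j).2
    show bpos n w ((j:ℕ)+2) < bpos n w ((j:ℕ)+1)
    omega
  step := by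
    intro k h1 h2
    obtain ⟨j, rfl⟩ : ∃ j : Fin (n-2), k = (j:ℕ) + 1 := ⟨⟨k - 1, by omega⟩, by simp; omega⟩
    have := bpos_succ n w j
    have := tpos_succ n w j
    have := (w j).2
    show tpos n w ((j:ℕ)+2) + bpos n w ((j:ℕ)+1) = tpos n w ((j:ℕ)+1) + bpos n w ((j:ℕ)+2) + 6
    omega

lemma oct_lt (n : ℕ) (hn : 3 ≤ n) (w w' : Fin (n - 2) → Fin 5)
    (i : Fin (n - 2)) (hi : (w i : ℕ) = 1 ∨ (w i : ℕ) = 3)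
    (h1 : ∀ j : Fin (n-2), (j:ℕ) < i → w' j = w j) (h2 : (w' i : ℕ) = 2)
    (h3 : ∀ j : Fin (n-2), (i:ℕ) < j → (w' j : ℕ) = 4 - (w j : ℕ)) :
    kirchhoff (octChain n w) < kirchhoff (octChain n w') := by
  have h := ch_oct n hn w
  have h' := ch_oct n hn w'
  have hi2 := i.2
  have ht := tpos_succ n w i
  have ht' := tpos_succ n w' i
  have hb := bpos_succ n w i
  have ht1 : ∀ j, 1 ≤ j → j ≤ (i:ℕ)+1 → tpos n w' j = tpos n w j := by
    intro j _ hj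
    unfold tpos
    congr 1
    apply Finset.sum_congr rfl
    intro l hl
    simp only [Finset.mem_filter, Finset.mem_univ, true_and] at hl
    rw [h1 l (by omega)]
  have hb1 : ∀ j, 1 ≤ j → j ≤ (i:ℕ)+1 → bpos n w' j = bpos n w j := by
    intro j hj hj2
    have a1 := h.gap j hj (by omega)
    have a2 := h'.gap j hj (by omega)
    have := ht1 j hj hj2
    omega
  have ht1i := ht1 ((i:ℕ)+1) (by omega) (by omega)
  have main : ∀ S, S = tpos n w' ((i:ℕ)+2) + bpos n w ((i:ℕ)+2) →
      ∀ d, (i:ℕ)+2+d ≤ n - 1 → tpos n w' ((i:ℕ)+2+d) + bpos n w ((i:ℕ)+2+d) = S := by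
    intro S hS d
    induction d with
    | zero => intro _; exact hS.symm
    | succ d ih =>
      intro hd
      have ih := ih (by omega)
      have a1 := tpos_succ n w' ⟨(i:ℕ)+1+d, by omega⟩
      have a2 := bpos_succ n w ⟨(i:ℕ)+1+d, by omega⟩
      have a3 := h3 ⟨(i:ℕ)+1+d, by omega⟩ (by simp; omega)
      have a4 := (w ⟨(i:ℕ)+1+d, by omega⟩).2
      simp only [] at a1 a2
      rw [show (i:ℕ)+1+d+1 = (i:ℕ)+2+d by ring, show (i:ℕ)+1+d+2 = (i:ℕ)+2+(d+1) by ring] at a1 a2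
      omega
  have hc : (tpos n w ((i:ℕ)+1+1) = tpos n w ((i:ℕ)+1) + 2 ∧
        bpos n w ((i:ℕ)+1) = bpos n w ((i:ℕ)+1+1) + 4) ∨
      (tpos n w ((i:ℕ)+1+1) = tpos n w ((i:ℕ)+1) + 4 ∧
        bpos n w ((i:ℕ)+1) = bpos n w ((i:ℕ)+1+1) + 2) := by
    rw [show (i:ℕ)+1+1 = (i:ℕ)+2 by ring]
    omega
  obtain ⟨s, hs⟩ : ∃ s, s = if tpos n w ((i:ℕ)+1+1) = tpos n w ((i:ℕ)+1) + 2 then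
    tpos n w ((i:ℕ)+1) + 2 else tpos n w ((i:ℕ)+1) + 3 := ⟨_, rfl⟩
  obtain ⟨e, he⟩ : ∃ e, e = if tpos n w ((i:ℕ)+1+1) = tpos n w ((i:ℕ)+1) + 2 then
    bpos n w ((i:ℕ)+1+1) + 1 else bpos n w ((i:ℕ)+1+1) := ⟨_, rfl⟩
  have hS : s + e = tpos n w' ((i:ℕ)+2) + bpos n w ((i:ℕ)+2) := by
    rw [show (i:ℕ)+1+1 = (i:ℕ)+2 by ring] at hs he hc
    split_ifs at hs he <;> omega
  have ht2 : ∀ j, (i:ℕ)+1 < j → j ≤ n - 1 → tpos n w' j + bpos n w j = s + e := by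
    intro j hj hj2
    obtain ⟨d, rfl⟩ : ∃ d, j = (i:ℕ)+2+d := ⟨j - (i+2), by omega⟩
    exact main _ hS d hj2
  refine core h h' ((i:ℕ)+1) (by omega) (by omega) hc s e hs he ht1 hb1 ht2 ?_
  intro j hj hj2
  have a0 := ht2 j hj hj2
  have a1 := h.gap j (by omega) hj2
  have a2 := h'.gap j (by omega) hj2
  omega

/-- Lemma 6 of the paper. If `w_i = 1` or `w_i = 3` for some `i`, and
`w' = (w_1,…,w_{i-1}, 2, 4-w_{i+1},…,4-w_{n-2})`, then `Kf(O(w)) < Kf(O(w'))`. -/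
theorem kirchhoff_lt_of_oneThree_to_two (n : ℕ) (hn : 3 ≤ n) (w : Fin (n - 2) → Fin 5)
    (i : Fin (n - 2)) (hi : w i = 1 ∨ w i = 3) :
    kirchhoff (octChain n w) <
      kirchhoff (octChain n (fun j => if (j : ℕ) < (i : ℕ) then w j
        else if j = i then (2 : Fin 5) else ⟨4 - (w j : ℕ), by omega⟩)) := by
  apply oct_lt n hn w _ i
  · rcases hi with hi | hi <;> simp [hi]
  · intro j hj
    simp [hj]
  · simp
  · intro j hj
    have e1 : ¬ ((j:ℕ) < (i:ℕ)) := by omega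
    have e2 : j ≠ i := by
      intro hji
      subst hji
      omega
    simp [e1, e2]
end

section
/- Let O(w) be an octagonal chain with n octagons, with octagons H_0, H_1, ..., H_{n−1} such that H_{i−1} and H_i share the vertical edge t_i b_i (t_i the top common vertex, b_i the bottom one), regarded as a weighted graph in which every edge carries a positive resistance, the shared edge t_{n−1}b_{n−1} has resistance 1, and every edge of the last octagon H_{n−1} has resistance 1. Let u be the degree-2 vertex of H_{n−1} adjacent to t_{n−1} and let v be the other neighbor of u. Then for every vertex z of the first octagon H_0 other than t_1 and b_1, the effective resistances satisfy r_{O(w)}(z,u) < r_{O(w)}(z,v). -/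
open Matrix in
theorem Network.lap_mulVec_aux {V : Type} [Fintype V] [DecidableEq V] (N : Network V)
    (f : V → ℝ) (x : V) : (N.lap *ᵥ f) x = ∑ y, N.cond x y * (f x - f y) := by
  have h : ∀ y, N.lap x y * f y
      = (if x = y then (∑ t, N.cond x t) * f x else 0) - N.cond x y * f y := by
    intro y
    unfold Network.lap
    by_cases hxy : x = y
    · subst hxy; simp [N.loopless]
    · simp [hxy]
  simp only [Matrix.mulVec, dotProduct, h, Finset.sum_sub_distrib, mul_sub,
    Finset.sum_ite_eq, Finset.mem_univ, if_true, Finset.sum_mul]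

theorem Network.lap_symm_aux {V : Type} [Fintype V] [DecidableEq V] (N : Network V) :
    N.lap.transpose = N.lap := by
  ext a b
  simp only [Matrix.transpose_apply, Network.lap]
  by_cases h : a = b
  · subst h; rfl
  · rw [if_neg h, if_neg (Ne.symm h), N.symm]

open Matrix in
theorem Network.lap_sum_aux {V : Type} [Fintype V] [DecidableEq V] (N : Network V)
    (f : V → ℝ) (S : Finset V) : ∑ x ∈ S, (N.lap *ᵥ f) x
      = ∑ x ∈ S, ∑ y ∈ Finset.univ.filter (fun y => y ∉ S), N.cond x y * (f x - f y) := by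
  have h0 : ∑ x ∈ S, ∑ y ∈ S, N.cond x y * (f x - f y) = 0 := by
    have h1 : ∑ x ∈ S, ∑ y ∈ S, N.cond x y * (f x - f y)
        = ∑ x ∈ S, ∑ y ∈ S, -(N.cond x y * (f x - f y)) := by
      rw [Finset.sum_comm]
      refine Finset.sum_congr rfl fun x _ => Finset.sum_congr rfl fun y _ => ?_
      rw [N.symm y x]; ring
    simp only [Finset.sum_neg_distrib] at h1
    linarith
  have h2 : ∀ x, (N.lap *ᵥ f) x = ∑ y ∈ S, N.cond x y * (f x - f y)
      + ∑ y ∈ Finset.univ.filter (fun y => y ∉ S), N.cond x y * (f x - f y) := by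
    intro x
    rw [N.lap_mulVec_aux, ← Finset.sum_filter_add_sum_filter_not Finset.univ (fun y => y ∈ S)]
    simp
  simp only [h2, Finset.sum_add_distrib, h0, zero_add]

open Matrix in
theorem Network.energy_aux {V : Type} [Fintype V] [DecidableEq V] (N : Network V)
    (f : V → ℝ) (hf : N.lap *ᵥ f = 0) (a b : V) (hab : N.cond a b ≠ 0) : f a = f b := by
  have h0 : ∑ x, ∑ y, N.cond x y * (f x - f y) ^ 2 = 0 := by
    have h1 : ∑ x, ∑ y, f x * (N.cond x y * (f x - f y)) = 0 := by
      simp only [← Finset.mul_sum, ← N.lap_mulVec_aux, hf]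
      simp
    have h2 : ∑ x, ∑ y, f y * (N.cond x y * (f y - f x)) = 0 := by
      rw [Finset.sum_comm, ← h1]
      refine Finset.sum_congr rfl fun x _ => Finset.sum_congr rfl fun y _ => ?_
      rw [N.symm y x]
    rw [← add_zero (0 : ℝ)]
    nth_rewrite 1 [← h1]
    rw [← h2]
    simp only [← Finset.sum_add_distrib]
    refine Finset.sum_congr rfl fun x _ => Finset.sum_congr rfl fun y _ => ?_
    ring
  have hnn : ∀ x y, 0 ≤ N.cond x y * (f x - f y) ^ 2 :=
    fun x y => mul_nonneg (N.nonneg x y) (sq_nonneg _)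
  rw [Finset.sum_eq_zero_iff_of_nonneg (fun x _ => Finset.sum_nonneg fun y _ => hnn x y)] at h0
  have h3 := h0 a (Finset.mem_univ _)
  rw [Finset.sum_eq_zero_iff_of_nonneg (fun y _ => hnn a y)] at h3
  have h4 := h3 b (Finset.mem_univ _)
  have h5 : (f a - f b) ^ 2 = 0 := (mul_eq_zero.mp h4).resolve_left hab
  have := pow_eq_zero_iff (two_ne_zero) |>.mp h5
  linarith

open Matrix in
/-- existence of the pseudoinverse when the kernel consists of the constants -/
theorem Network.mp_exists_aux {V : Type} [Fintype V] [DecidableEq V] [Nonempty V] (N : Network V)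
    (hker : ∀ f : V → ℝ, N.lap *ᵥ f = 0 → ∀ a b, f a = f b) :
    ∃ M, N.lap.IsMoorePenroseInv M := by
  set c : ℝ := (Fintype.card V : ℝ) with hc
  have hc0 : c ≠ 0 := by rw [hc]; exact_mod_cast Fintype.card_ne_zero
  set P : Matrix V V ℝ := Matrix.of (fun _ _ => c⁻¹) with hP
  have hPapp : ∀ a b, P a b = c⁻¹ := fun a b => rfl
  have hPP : P * P = P := by
    ext a b
    simp only [Matrix.mul_apply, hPapp, Finset.sum_const, Finset.card_univ, nsmul_eq_mul]
    rw [← hc]; field_simp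
  have hPT : Pᵀ = P := by ext a b; rfl
  have hLP : N.lap * P = 0 := by
    ext a b
    have := N.lap_mulVec_aux (fun _ => c⁻¹) a
    simp only [sub_self, mul_zero, Finset.sum_const_zero] at this
    exact this
  have hPL : P * N.lap = 0 := by
    have := congrArg Matrix.transpose hLP
    rwa [Matrix.transpose_mul, hPT, N.lap_symm_aux, Matrix.transpose_zero] at this
  set A := N.lap + P with hA
  have hinj : Function.Injective A.mulVec := by
    rw [Matrix.mulVec_injective_iff_isUnit]
    rw [← Matrix.mulVec_injective_iff_isUnit]
    intro f g hfg
    have h0 : A *ᵥ (f - g) = 0 := by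
      rw [Matrix.mulVec_sub]; exact sub_eq_zero.mpr hfg
    have hPv : P *ᵥ (f - g) = 0 := by
      have : P *ᵥ (A *ᵥ (f - g)) = 0 := by rw [h0, Matrix.mulVec_zero]
      rwa [Matrix.mulVec_mulVec, hA, Matrix.mul_add, hPL, hPP, zero_add] at this
    have hLv : N.lap *ᵥ (f - g) = 0 := by
      rw [hA, Matrix.add_mulVec, hPv, add_zero] at h0; exact h0
    have hcst := hker _ hLv
    ext a
    have h1 := congrFun hPv a
    simp only [Matrix.mulVec, dotProduct, hPapp, Pi.zero_apply] at h1
    rw [Finset.sum_congr rfl (fun b _ => by rw [hcst b a])] at h1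
    rw [Finset.sum_const, Finset.card_univ, nsmul_eq_mul, ← hc, ← mul_assoc,
      mul_inv_cancel₀ hc0, one_mul] at h1
    simpa [sub_eq_zero] using h1
  have hunit : IsUnit A := Matrix.mulVec_injective_iff_isUnit.mp hinj
  have hdet : IsUnit A.det := (Matrix.isUnit_iff_isUnit_det A).mp hunit
  have hAi : A * A⁻¹ = 1 := Matrix.mul_nonsing_inv _ hdet
  have hiA : A⁻¹ * A = 1 := Matrix.nonsing_inv_mul _ hdet
  have hAP : A * P = P := by rw [hA, Matrix.add_mul, hLP, hPP, zero_add]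
  have hPA : P * A = P := by rw [hA, Matrix.mul_add, hPL, hPP, zero_add]
  have hiP : A⁻¹ * P = P := by
    calc A⁻¹ * P = A⁻¹ * (A * P) := by rw [hAP]
      _ = P := by rw [← Matrix.mul_assoc, hiA, Matrix.one_mul]
  have hPi : P * A⁻¹ = P := by
    calc P * A⁻¹ = (P * A) * A⁻¹ := by rw [hPA]
      _ = P := by rw [Matrix.mul_assoc, hAi, Matrix.mul_one]
  have hL : N.lap = A - P := by rw [hA]; abel
  have hLM : N.lap * (A⁻¹ - P) = 1 - P := by
    rw [Matrix.mul_sub, hLP, sub_zero, hL, Matrix.sub_mul, hAi, hPi]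
  have hML : (A⁻¹ - P) * N.lap = 1 - P := by
    rw [Matrix.sub_mul, hPL, sub_zero, hL, Matrix.mul_sub, hiA, hiP]
  refine ⟨A⁻¹ - P, ?_, ?_, ?_, ?_⟩
  · rw [hLM, Matrix.sub_mul, hPL, Matrix.one_mul, sub_zero]
  · rw [hML, Matrix.sub_mul, Matrix.one_mul, Matrix.mul_sub, hPi, hPP]; abel
  · rw [hLM, Matrix.transpose_sub, hPT, Matrix.transpose_one]
  · rw [hML, Matrix.transpose_sub, hPT, Matrix.transpose_one]

open Matrix in
/-- the pseudoinverse solves the Poisson equation -/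
theorem Network.poisson_aux {V : Type} [Fintype V] [DecidableEq V] [Nonempty V] (N : Network V)
    (hker : ∀ f : V → ℝ, N.lap *ᵥ f = 0 → ∀ a b, f a = f b)
    (g : V → ℝ) (hg : ∑ x, g x = 0) : N.lap *ᵥ (mpinv N.lap *ᵥ g) = g := by
  have hM : N.lap.IsMoorePenroseInv (mpinv N.lap) := by
    have h := N.mp_exists_aux hker
    unfold mpinv
    rw [dif_pos h]
    exact h.choose_spec
  obtain ⟨h1, h2, h3, h4⟩ := hM
  set L := N.lap with hLdef
  set M := mpinv L
  have hLT : Lᵀ = L := N.lap_symm_aux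
  have hLLM : L * (L * M) = L := by
    have := congrArg Matrix.transpose h1
    rw [Matrix.transpose_mul, h3, hLT] at this
    exact this
  have hy : L *ᵥ (g - L *ᵥ (M *ᵥ g)) = 0 := by
    rw [Matrix.mulVec_sub, Matrix.mulVec_mulVec, Matrix.mulVec_mulVec, Matrix.mul_assoc, hLLM, sub_self]
  have hcst := hker _ hy
  have hs : ∑ x, (g - L *ᵥ (M *ᵥ g)) x = 0 := by
    have := N.lap_sum_aux (M *ᵥ g) Finset.univ
    simp only [Finset.mem_univ, not_true_eq_false, Finset.filter_false, Finset.sum_empty,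
      Finset.sum_const_zero] at this
    simp only [Pi.sub_apply, Finset.sum_sub_distrib, hg]
    rw [this, sub_zero]
  ext a
  rw [Finset.sum_congr rfl (fun b _ => hcst b a), Finset.sum_const, Finset.card_univ,
    nsmul_eq_mul] at hs
  have hc0 : (Fintype.card V : ℝ) ≠ 0 := by exact_mod_cast Fintype.card_ne_zero
  have := (mul_eq_zero.mp hs).resolve_left hc0
  simp only [Pi.sub_apply] at this
  linarith

open Matrix in
/-- comparison of effective resistances through one potential -/
theorem Network.effRes_diff_aux {V : Type} [Fintype V] [DecidableEq V] [Nonempty V]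
    (N : Network V)
    (hker : ∀ f : V → ℝ, N.lap *ᵥ f = 0 → ∀ a b, f a = f b) (z u v : V) :
    ∃ f : V → ℝ, N.lap *ᵥ f = Pi.single u 1 + Pi.single v 1 - 2 • Pi.single z 1 ∧
      N.effRes z v - N.effRes z u = f v - f u := by
  set M := mpinv N.lap with hMdef
  refine ⟨M *ᵥ (Pi.single u 1 + Pi.single v 1 - 2 • Pi.single z 1), ?_, ?_⟩
  · apply N.poisson_aux hker
    simp [Finset.sum_add_distrib, Finset.sum_sub_distrib, ← Finset.mul_sum]
    norm_num
  · have key : ∀ g h : V → ℝ, ∑ x, g x = 0 → ∑ x, h x = 0 → g ⬝ᵥ (M *ᵥ h) = h ⬝ᵥ (M *ᵥ g) := by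
      intro g h hg hh
      have e1 := N.poisson_aux hker g hg
      have e2 := N.poisson_aux hker h hh
      rw [← hMdef] at e1 e2
      calc g ⬝ᵥ (M *ᵥ h) = (N.lap *ᵥ (M *ᵥ g)) ⬝ᵥ (M *ᵥ h) := by rw [e1]
        _ = (M *ᵥ g) ⬝ᵥ (N.lap *ᵥ (M *ᵥ h)) := by
          rw [Matrix.dotProduct_mulVec (M *ᵥ g) N.lap, ← Matrix.mulVec_transpose, N.lap_symm_aux]
        _ = h ⬝ᵥ (M *ᵥ g) := by rw [e2, dotProduct_comm]
    have k := key (Pi.single z 1 - Pi.single u 1) (Pi.single z 1 - Pi.single v 1)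
      (by simp) (by simp)
    simp only [Matrix.mulVec_sub, Matrix.mulVec_add, Matrix.mulVec_single_one, sub_dotProduct,
      dotProduct_sub, single_one_dotProduct, Matrix.col_apply, Matrix.mulVec_smul, two_smul,
      Pi.sub_apply, Pi.add_apply] at k ⊢
    unfold Network.effRes
    rw [← hMdef]
    linarith

open Matrix in
/-- the core comparison, for a network on `Fin m` whose vertices `T, …, T+5` only have their
path neighbours -/
theorem Network.core_aux {m : ℕ} (N : Network (Fin m)) (f : Fin m → ℝ) (T : ℕ) (hT : 1 ≤ T)
    (hTm : T + 6 < m)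
    (hpath : ∀ a b : Fin m, T ≤ (a : ℕ) → (a : ℕ) ≤ T + 5 → N.cond a b ≠ 0 →
      (b : ℕ) = (a : ℕ) + 1 ∨ (b : ℕ) + 1 = (a : ℕ))
    (hlast : ∀ a b : Fin m, T - 1 ≤ (a : ℕ) → (a : ℕ) ≤ T + 5 → (b : ℕ) = (a : ℕ) + 1 →
      N.cond a b = 1)
    (hshared : ∀ a b : Fin m, (a : ℕ) = T - 1 → (b : ℕ) = T + 6 → N.cond a b = 1)
    (z u v : Fin m) (hz : (z : ℕ) < T ∨ T + 6 ≤ (z : ℕ)) (hu : (u : ℕ) = T)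
    (hv : (v : ℕ) = T + 1)
    (hf : N.lap *ᵥ f = Pi.single u 1 + Pi.single v 1 - 2 • Pi.single z 1) : f u < f v := by
  have hrow : ∀ a b c : Fin m, T ≤ (b : ℕ) → (b : ℕ) ≤ T + 5 → (b : ℕ) = (a : ℕ) + 1 →
      (c : ℕ) = (b : ℕ) + 1 → (N.lap *ᵥ f) b = (f b - f a) + (f b - f c) := by
    intro a b c h1 h2 h3 h4
    rw [N.lap_mulVec_aux]
    have hac : a ≠ c := by intro h; rw [h] at h3; omega
    rw [Finset.sum_eq_add a c hac]
    · rw [N.symm b a, hlast a b (by omega) (by omega) h3, hlast b c (by omega) h2 h4]; ring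
    · intro y _ hy
      by_contra hne
      have hne' : N.cond b y ≠ 0 := fun h => hne (by rw [h, zero_mul])
      rcases hpath b y h1 h2 hne' with h | h
      · exact hy.2 (Fin.ext (by omega))
      · exact hy.1 (Fin.ext (by omega))
    · simp
    · simp
  have hval : ∀ x : Fin m, (N.lap *ᵥ f) x
      = (if x = u then 1 else 0) + (if x = v then 1 else 0) - 2 * (if x = z then 1 else 0) := by
    intro x
    rw [hf]
    simp [Pi.single_apply]
  obtain ⟨t, ht⟩ : ∃ t : Fin m, (t : ℕ) = T - 1 := ⟨⟨T - 1, by omega⟩, rfl⟩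
  obtain ⟨p3, h3⟩ : ∃ t : Fin m, (t : ℕ) = T + 2 := ⟨⟨T + 2, by omega⟩, rfl⟩
  obtain ⟨p4, h4⟩ : ∃ t : Fin m, (t : ℕ) = T + 3 := ⟨⟨T + 3, by omega⟩, rfl⟩
  obtain ⟨p5, h5⟩ : ∃ t : Fin m, (t : ℕ) = T + 4 := ⟨⟨T + 4, by omega⟩, rfl⟩
  obtain ⟨p6, h6⟩ : ∃ t : Fin m, (t : ℕ) = T + 5 := ⟨⟨T + 5, by omega⟩, rfl⟩
  obtain ⟨b, hb⟩ : ∃ t : Fin m, (t : ℕ) = T + 6 := ⟨⟨T + 6, by omega⟩, rfl⟩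
  have hne : ∀ x y : Fin m, (x : ℕ) ≠ (y : ℕ) → x ≠ y := fun x y h h' => h (by rw [h'])
  have e1 := hrow t u v (by omega) (by omega) (by omega) (by omega)
  have e2 := hrow u v p3 (by omega) (by omega) (by omega) (by omega)
  have e3 := hrow v p3 p4 (by omega) (by omega) (by omega) (by omega)
  have e4 := hrow p3 p4 p5 (by omega) (by omega) (by omega) (by omega)
  have e5 := hrow p4 p5 p6 (by omega) (by omega) (by omega) (by omega)
  have e6 := hrow p5 p6 b (by omega) (by omega) (by omega) (by omega)
  rw [hval, if_pos rfl, if_neg (hne _ _ (by omega)), if_neg (hne _ _ (by omega))] at e1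
  rw [hval, if_neg (hne _ _ (by omega)), if_pos rfl, if_neg (hne _ _ (by omega))] at e2
  rw [hval, if_neg (hne _ _ (by omega)), if_neg (hne _ _ (by omega)),
    if_neg (hne _ _ (by omega))] at e3 e4 e5 e6
  by_contra hcon
  have hd : f v ≤ f u := not_lt.mp hcon
  have htb : f t - f b = 4 + 7 * (f u - f v) := by linarith
  set S : Finset (Fin m) :=
    Finset.univ.filter (fun x => ((x : ℕ) < T ∨ T + 6 ≤ (x : ℕ)) ∧ f t ≤ f x) with hS
  have memS : ∀ x, x ∈ S ↔ ((x : ℕ) < T ∨ T + 6 ≤ (x : ℕ)) ∧ f t ≤ f x := by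
    intro x; simp [hS]
  have htS : t ∈ S := (memS t).2 ⟨by omega, le_refl _⟩
  have hbS : b ∉ S := fun h => by have := ((memS b).1 h).2; linarith
  have huS : u ∉ S := fun h => by have := ((memS u).1 h).1; omega
  have hub : u ≠ b := hne _ _ (by omega)
  have hle : ∑ x ∈ S, (N.lap *ᵥ f) x ≤ 0 := by
    apply Finset.sum_nonpos
    intro x hx
    have hx1 := ((memS x).1 hx).1
    rw [hval, if_neg (hne _ _ (by omega)), if_neg (hne _ _ (by omega))]
    split_ifs <;> norm_num
  rw [N.lap_sum_aux] at hle
  have hterm : ∀ x ∈ S, ∀ y, y ∉ S → ¬ (x = t ∧ y = u) → 0 ≤ N.cond x y * (f x - f y) := by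
    intro x hx y hy hxy
    obtain ⟨hx1, hx2⟩ := (memS x).1 hx
    by_cases hc : N.cond x y = 0
    · rw [hc, zero_mul]
    by_cases hyo : (y : ℕ) < T ∨ T + 6 ≤ (y : ℕ)
    · have : f y < f t := by
        by_contra h
        exact hy ((memS y).2 ⟨hyo, not_lt.mp h⟩)
      exact mul_nonneg (N.nonneg _ _) (by linarith)
    · exfalso
      have hc' : N.cond y x ≠ 0 := by rwa [N.symm]
      rcases hpath y x (by omega) (by omega) hc' with h | h
      · have : x = b := Fin.ext (by omega)
        exact hbS (this ▸ hx)
      · exact hxy ⟨Fin.ext (by omega), Fin.ext (by omega)⟩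
  have hge1 : ∑ y ∈ Finset.univ.filter (fun y => y ∉ S), N.cond t y * (f t - f y)
      ≤ ∑ x ∈ S, ∑ y ∈ Finset.univ.filter (fun y => y ∉ S), N.cond x y * (f x - f y) := by
    rw [← Finset.add_sum_erase S _ htS]
    apply le_add_of_nonneg_right
    apply Finset.sum_nonneg
    intro x hx
    apply Finset.sum_nonneg
    intro y hy
    exact hterm x (Finset.mem_of_mem_erase hx) y (Finset.mem_filter.1 hy).2
      (fun h => Finset.ne_of_mem_erase hx h.1)
  have hge2 : N.cond t u * (f t - f u) + N.cond t b * (f t - f b)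
      ≤ ∑ y ∈ Finset.univ.filter (fun y => y ∉ S), N.cond t y * (f t - f y) := by
    have hu' : u ∈ Finset.univ.filter (fun y => y ∉ S) := by simp [huS]
    have hb' : b ∈ (Finset.univ.filter (fun y => y ∉ S)).erase u := by
      simp [hbS, hub.symm]
    rw [← Finset.add_sum_erase _ _ hu', ← Finset.add_sum_erase _ _ hb', ← add_assoc]
    apply le_add_of_nonneg_right
    apply Finset.sum_nonneg
    intro y hy
    have hy1 := Finset.mem_of_mem_erase hy
    exact hterm t htS y (Finset.mem_filter.1 (Finset.mem_of_mem_erase hy1)).2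
      (fun h => Finset.ne_of_mem_erase hy1 h.2)
  rw [hlast t u (by omega) (by omega) (by omega), hshared t b ht hb] at hge2
  linarith

/-- Lemma 8 of the paper. Let `O(w)` be an octagonal chain with `n`
octagons regarded as a weighted graph (a network `N` whose support is exactly `O(w)`),
in which the shared edge `t_{n-1}b_{n-1}` and every edge of the last octagon `H_{n-1}`
carry resistance `1`.  In the boundary labelling, `t_{n-1}` is at position
`T - 1` where `T = n + (w_1 + ⋯ + w_{n-2})`, the degree-2 vertex `u` of `H_{n-1}`
adjacent to `t_{n-1}` is at position `T`, its other neighbour `v` is at position `T + 1`,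
`b_{n-1}` is at position `T + 6`, and the vertices of `H_0` other than `t_1, b_1` are the
positions `0` and `6n-3, …, 6n+1`.  Then `r(z,u) < r(z,v)` for every such `z`. -/
theorem last_octagon_resistance_comparison (n : ℕ) (hn : 3 ≤ n)
    (w : Fin (n - 2) → Fin 5) (N : Network (Fin (6 * n + 2)))
    (hsupp : ∀ a b, N.cond a b ≠ 0 ↔ (octChain n w).Adj a b)
    (hlast : ∀ a b : Fin (6 * n + 2),
      n + (∑ j, ((w j : ℕ))) - 1 ≤ (a : ℕ) → (a : ℕ) ≤ n + (∑ j, ((w j : ℕ))) + 5 →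
      (b : ℕ) = (a : ℕ) + 1 → N.cond a b = 1)
    (hshared : ∀ a b : Fin (6 * n + 2),
      (a : ℕ) = n + (∑ j, ((w j : ℕ))) - 1 → (b : ℕ) = n + (∑ j, ((w j : ℕ))) + 6 →
      N.cond a b = 1)
    (z u v : Fin (6 * n + 2))
    (hz : (z : ℕ) = 0 ∨ 6 * n - 3 ≤ (z : ℕ))
    (hu : (u : ℕ) = n + (∑ j, ((w j : ℕ))))
    (hv : (v : ℕ) = n + (∑ j, ((w j : ℕ))) + 1) :
    N.effRes z u < N.effRes z v := by
  classical
  have hsum : ∑ j, ((w j : ℕ)) ≤ 4 * (n - 2) := by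
    calc ∑ j, ((w j : ℕ)) ≤ ∑ _j : Fin (n - 2), 4 :=
          Finset.sum_le_sum fun j _ => by have := (w j).isLt; omega
      _ = 4 * (n - 2) := by simp [mul_comm]
  have htp : ∀ k, k ≤ n - 1 → tpos n w k + 1 ≤ n + ∑ j, ((w j : ℕ)) := by
    intro k hk
    have : ∑ j ∈ Finset.univ.filter (fun j : Fin (n - 2) => (j : ℕ) + 1 < k), ((w j : ℕ))
        ≤ ∑ j, ((w j : ℕ)) := Finset.sum_le_sum_of_subset (Finset.filter_subset _ _)
    unfold tpos
    omega
  have hbp : ∀ k, n + (∑ j, ((w j : ℕ))) + 6 ≤ bpos n w k := by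
    intro k; unfold bpos; omega
  have hker : ∀ f : Fin (6 * n + 2) → ℝ, Matrix.mulVec N.lap f = 0 → ∀ a b, f a = f b := by
    intro f hf
    have h0 : ∀ k (hk : k < 6 * n + 2), f ⟨k, hk⟩ = f ⟨0, by omega⟩ := by
      intro k
      induction k with
      | zero => intro _; rfl
      | succ k ih =>
        intro hk
        rw [← ih (by omega)]
        symm
        apply N.energy_aux f hf
        rw [hsupp]
        unfold octChain
        rw [SimpleGraph.fromRel_adj]
        refine ⟨?_, Or.inl (Or.inl rfl)⟩
        intro h
        have := congrArg Fin.val h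
        simp at this
    intro a b
    rw [h0 a a.isLt, h0 b b.isLt]
  obtain ⟨f, hf, hd⟩ := N.effRes_diff_aux hker z u v
  have := N.core_aux f (n + ∑ j, ((w j : ℕ))) (by omega) (by omega) ?_ hlast hshared z u v
    (by omega) hu hv hf
  · linarith
  · intro a b h1 h2 hab
    rw [hsupp] at hab
    unfold octChain at hab
    rw [SimpleGraph.fromRel_adj] at hab
    obtain ⟨-, (h | h | ⟨k, hk1, hk2, h3, h4⟩) | (h | h | ⟨k, hk1, hk2, h3, h4⟩)⟩ := hab
    · omega
    · omega
    · have := htp k hk2; omega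
    · omega
    · omega
    · have := hbp k; omega
end
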